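/- arXiv:2412.11156 — 3 statements merged into one kernel-verified Lean document; each statement's English description precedes it below -/
import Mathlib

section
/- Let d ≥ 1 be an integer and let Δ ⊆ [0,1]^d be a polytope of dimension d. Then there exist constants C > 0 and D₀ > 0 (depending only on d and Δ) such that the following holds: for every continuous function f : [0,1]^d → ℝ, every M ≥ 0 with |f(x)| ≤ M for all x ∈ [0,1]^d, and every finite sequence x₁,…,x_n ∈ [0,1)^d whose discrepancy D = D(x₁,…,x_n) satisfies D ≤ D₀, one has | (1/n) · Σ_{i : x_i ∈ Δ} f(x_i) − ∫_Δ f dμ | ≤ C · ( ρ(f, D^{1/(d+1)}) + M · D^{1/(2d+2)} ), where μ is Lebesgue measure, and ρ(f,t) = sup{ |f(x) − f(y)| : x, y ∈ [0,1]^d, max_i |x_i − y_i| ≤ t } is the modulus of continuity of f with respect to the maximum norm. -/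
open MeasureTheory Finset
open scoped Classical

/-- The discrepancy of a finite sequence `x₁, …, x_n` in `[0,1)^d`:
`sup_B | #{i : x_i ∈ B}/n − vol(B) |` over boxes `B = ∏ [a_i, b_i)` with
`0 ≤ a_i < b_i ≤ 1`. -/
noncomputable def discrepancy {d n : ℕ} (x : Fin n → (Fin d → ℝ)) : ℝ :=
  sSup {r | ∃ a b : Fin d → ℝ, (∀ i, 0 ≤ a i ∧ a i < b i ∧ b i ≤ 1) ∧
    r = |((Finset.univ.filter (fun j => ∀ i, a i ≤ x j i ∧ x j i < b i)).card : ℝ) / n -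
      ∏ i, (b i - a i)|}

/-- The modulus of continuity of `f` on `[0,1]^d` with respect to the maximum norm. -/
noncomputable def modCont {d : ℕ} (f : (Fin d → ℝ) → ℝ) (t : ℝ) : ℝ :=
  sSup {r | ∃ x y : Fin d → ℝ, x ∈ Set.pi Set.univ (fun _ => Set.Icc (0:ℝ) 1) ∧
    y ∈ Set.pi Set.univ (fun _ => Set.Icc (0:ℝ) 1) ∧
    (∀ i, |x i - y i| ≤ t) ∧ r = |f x - f y|}

def gcube {d : ℕ} (N : ℕ) (k : Fin d → ℕ) : Set (Fin d → ℝ) :=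
  Set.univ.pi fun i => Set.Ico ((k i : ℝ) / N) (((k i : ℝ) + 1) / N)

def gidx (d N : ℕ) : Finset (Fin d → ℕ) := Fintype.piFinset fun _ => Finset.range N

lemma gcube_meas {d : ℕ} (N : ℕ) (k : Fin d → ℕ) : MeasurableSet (gcube N k) :=
  MeasurableSet.univ_pi fun _ => measurableSet_Ico

lemma gcube_vol {d : ℕ} (N : ℕ) (k : Fin d → ℕ) :
    volume.real (gcube N k) = (1 / (N : ℝ)) ^ d := by
  rw [measureReal_def, gcube, Real.volume_pi_Ico_toReal]
  · simp [add_div]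
  · intro i
    simp only []
    gcongr; linarith

lemma gcube_vol_ne_top {d : ℕ} (N : ℕ) (k : Fin d → ℕ) : volume (gcube N k) ≠ ⊤ := by
  rw [gcube, Real.volume_pi_Ico]
  exact ENNReal.prod_ne_top fun i _ => ENNReal.ofReal_ne_top

lemma gcube_floor {d N : ℕ} (hN : 0 < N) {k : Fin d → ℕ} {y : Fin d → ℝ}
    (h : y ∈ gcube N k) : (fun i => ⌊(N : ℝ) * y i⌋₊) = k := by
  funext i
  have hN' : (0 : ℝ) < N := by exact_mod_cast hN
  obtain ⟨h1, h2⟩ := h i (Set.mem_univ i)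
  rw [div_le_iff₀ hN'] at h1
  rw [lt_div_iff₀ hN'] at h2
  have : (0 : ℝ) ≤ k i := by positivity
  rw [Nat.floor_eq_iff (by nlinarith)]
  constructor <;> linarith

lemma gcube_disj {d N : ℕ} (hN : 0 < N) {k l : Fin d → ℕ} (hkl : k ≠ l) :
    Disjoint (gcube N k) (gcube N l) := by
  rw [Set.disjoint_left]
  intro y h1 h2
  exact hkl ((gcube_floor hN h1).symm.trans (gcube_floor hN h2))

lemma gcube_mem_floor {d N : ℕ} (hN : 0 < N) {y : Fin d → ℝ}
    (h : y ∈ Set.pi Set.univ (fun _ => Set.Ico (0:ℝ) 1)) :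
    y ∈ gcube N (fun i => ⌊(N : ℝ) * y i⌋₊) ∧ (fun i => ⌊(N : ℝ) * y i⌋₊) ∈ gidx d N := by
  have hN' : (0 : ℝ) < N := by exact_mod_cast hN
  constructor
  · intro i _
    obtain ⟨h1, h2⟩ := h i (Set.mem_univ i)
    have a := Nat.floor_le (mul_nonneg hN'.le h1)
    have b := Nat.lt_floor_add_one ((N : ℝ) * y i)
    constructor
    · rw [div_le_iff₀ hN']; linarith
    · rw [lt_div_iff₀ hN']; linarith
  · rw [gidx, Fintype.mem_piFinset]
    intro i
    obtain ⟨h1, h2⟩ := h i (Set.mem_univ i)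
    rw [Finset.mem_range, Nat.floor_lt (mul_nonneg hN'.le h1)]
    nlinarith

lemma gidx_bd {d N : ℕ} (hN : 0 < N) {k : Fin d → ℕ} (hk : k ∈ gidx d N) (i : Fin d) :
    0 ≤ (k i : ℝ) / N ∧ (k i : ℝ) / N < ((k i : ℝ) + 1) / N ∧ ((k i : ℝ) + 1) / N ≤ 1 := by
  have hN' : (0 : ℝ) < N := by exact_mod_cast hN
  rw [gidx, Fintype.mem_piFinset] at hk
  have := hk i
  rw [Finset.mem_range] at this
  refine ⟨by positivity, by gcongr; linarith, ?_⟩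
  rw [div_le_one hN']
  exact_mod_cast this

lemma gcube_sub {d N : ℕ} (hN : 0 < N) {k : Fin d → ℕ} (hk : k ∈ gidx d N) :
    gcube N k ⊆ Set.pi Set.univ (fun _ => Set.Ico (0:ℝ) 1) := by
  intro y hy i hi
  obtain ⟨h1, h2⟩ := hy i hi
  obtain ⟨a, b, c⟩ := gidx_bd hN hk i
  exact ⟨a.trans h1, h2.trans_le c⟩

lemma gcube_union {d N : ℕ} (hN : 0 < N) :
    (⋃ k ∈ gidx d N, gcube N k) = Set.pi Set.univ (fun _ => Set.Ico (0:ℝ) 1) := by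
  apply Set.Subset.antisymm
  · exact Set.iUnion₂_subset fun k hk => gcube_sub hN hk
  · intro y hy
    obtain ⟨h1, h2⟩ := gcube_mem_floor hN hy
    exact Set.mem_iUnion₂.2 ⟨_, h2, h1⟩

lemma gcube_dist {d N : ℕ} {k : Fin d → ℕ} {y z : Fin d → ℝ}
    (hy : y ∈ gcube N k) (hz : z ∈ gcube N k) (i : Fin d) : |y i - z i| ≤ 1 / N := by
  obtain ⟨h1, h2⟩ := hy i (Set.mem_univ i)
  obtain ⟨h3, h4⟩ := hz i (Set.mem_univ i)
  rw [add_div] at h2 h4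
  rw [abs_le]; constructor <;> linarith

lemma gidx_card (d N : ℕ) : (gidx d N).card = N ^ d := by
  simp [gidx]

lemma disc_bdd {d n : ℕ} (hn : 0 < n) (x : Fin n → (Fin d → ℝ)) :
  BddAbove {r | ∃ a b : Fin d → ℝ, (∀ i, 0 ≤ a i ∧ a i < b i ∧ b i ≤ 1) ∧
    r = |((Finset.univ.filter (fun j => ∀ i, a i ≤ x j i ∧ x j i < b i)).card : ℝ) / n -
      ∏ i, (b i - a i)|} := by
  refine ⟨1, ?_⟩
  rintro r ⟨a, b, hab, rfl⟩
  have hn' : (0 : ℝ) < n := by exact_mod_cast hn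
  have h1 : ((Finset.univ.filter (fun j => ∀ i, a i ≤ x j i ∧ x j i < b i)).card : ℝ) / n ≤ 1 := by
    rw [div_le_one hn']
    have := Finset.card_filter_le (Finset.univ : Finset (Fin n))
      (fun j => ∀ i, a i ≤ x j i ∧ x j i < b i)
    rw [Finset.card_univ, Fintype.card_fin] at this
    exact_mod_cast this
  have h2 : ∏ i, (b i - a i) ≤ 1 := Finset.prod_le_one
    (fun i _ => by have := hab i; linarith) (fun i _ => by have := hab i; linarith)
  have h3 : 0 ≤ ∏ i, (b i - a i) := Finset.prod_nonneg
    (fun i _ => by have := hab i; linarith)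
  have h4 : (0:ℝ) ≤ ((Finset.univ.filter
    (fun j => ∀ i, a i ≤ x j i ∧ x j i < b i)).card : ℝ) / n := by positivity
  rw [abs_le]; constructor <;> linarith

lemma disc_ge {d n : ℕ} (hn : 0 < n) (x : Fin n → (Fin d → ℝ)) (a b : Fin d → ℝ)
    (hab : ∀ i, 0 ≤ a i ∧ a i < b i ∧ b i ≤ 1) :
    |((Finset.univ.filter (fun j => ∀ i, a i ≤ x j i ∧ x j i < b i)).card : ℝ) / n -
      ∏ i, (b i - a i)| ≤ discrepancy x :=
  le_csSup (disc_bdd hn x) ⟨a, b, hab, rfl⟩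

lemma disc_pos {d n : ℕ} (hd : 1 ≤ d) (hn : 0 < n) (x : Fin n → (Fin d → ℝ))
    (hx : ∀ j, x j ∈ Set.pi Set.univ (fun _ => Set.Ico (0:ℝ) 1)) : 0 < discrepancy x := by
  have hn' : (1 : ℝ) ≤ n := by exact_mod_cast hn
  set a := x ⟨0, hn⟩ with ha
  have hx0 := hx ⟨0, hn⟩
  rw [← ha] at hx0
  have e : (1 : ℝ) / (2 * n) ≤ 1 / 2 := by
    gcongr; linarith
  have e0 : (0:ℝ) < 1 / (2 * n) := by positivity
  have h := disc_ge hn x a (fun i => a i + (1 - a i) * (1 / (2 * n))) (by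
    intro i
    obtain ⟨h1, h2⟩ := hx0 i (Set.mem_univ i)
    refine ⟨h1, ?_, ?_⟩
    · have : 0 < (1 - a i) * (1 / (2 * n)) := mul_pos (by linarith) e0
      linarith
    · nlinarith)
  have hp : ∏ i, (a i + (1 - a i) * (1 / (2 * (n:ℝ))) - a i) ≤ 1 / (2 * n) := by
    calc _ ≤ ∏ i : Fin d, (1 / (2 * (n:ℝ))) := by
          apply Finset.prod_le_prod
          · intro i _
            obtain ⟨h1, h2⟩ := hx0 i (Set.mem_univ i)
            have : 0 < (1 - a i) * (1 / (2 * n)) := mul_pos (by linarith) e0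
            linarith
          · intro i _
            obtain ⟨h1, h2⟩ := hx0 i (Set.mem_univ i)
            nlinarith
      _ = (1 / (2 * (n:ℝ))) ^ d := by simp
      _ ≤ _ := pow_le_of_le_one e0.le (by linarith) (by omega)
  have hc : (1:ℝ) / n ≤ ((Finset.univ.filter (fun j => ∀ i, a i ≤ x j i ∧
      x j i < a i + (1 - a i) * (1 / (2 * (n:ℝ))))).card : ℝ) / n := by
    gcongr
    have : 0 < (Finset.univ.filter (fun j => ∀ i, a i ≤ x j i ∧
      x j i < a i + (1 - a i) * (1 / (2 * (n:ℝ))))).card := by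
      rw [Finset.card_pos]
      refine ⟨⟨0, hn⟩, ?_⟩
      simp only [Finset.mem_filter, Finset.mem_univ, true_and]
      intro i
      obtain ⟨h1, h2⟩ := hx0 i (Set.mem_univ i)
      have : 0 < (1 - a i) * (1 / (2 * n)) := mul_pos (by linarith) e0
      rw [← ha]
      exact ⟨le_rfl, by linarith⟩
    exact_mod_cast this
  have h5 := (le_abs_self _).trans h
  have e2 : (1:ℝ) / n = 2 * (1 / (2 * n)) := by field_simp
  linarith

lemma disc_cube {d n N : ℕ} (hn : 0 < n) (hN : 0 < N) (x : Fin n → (Fin d → ℝ))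
    {k : Fin d → ℕ} (hk : k ∈ gidx d N) :
    |((Finset.univ.filter (fun j => x j ∈ gcube N k)).card : ℝ) / n - (1 / (N:ℝ)) ^ d|
      ≤ discrepancy x := by
  have h := disc_ge hn x (fun i => (k i : ℝ) / N) (fun i => ((k i : ℝ) + 1) / N) (gidx_bd hN hk)
  have e : ∏ i, (((k i : ℝ) + 1) / N - (k i : ℝ) / N) = (1 / (N:ℝ)) ^ d := by
    simp [add_div]
  rw [e] at h
  convert h using 6
  simp [gcube, Set.mem_pi]

lemma mod_le {d : ℕ} {f : (Fin d → ℝ) → ℝ} {M t : ℝ}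
    (hM : ∀ x ∈ Set.pi Set.univ (fun _ => Set.Icc (0:ℝ) 1), |f x| ≤ M) {x y : Fin d → ℝ}
    (hx : x ∈ Set.pi Set.univ (fun _ => Set.Icc (0:ℝ) 1))
    (hy : y ∈ Set.pi Set.univ (fun _ => Set.Icc (0:ℝ) 1)) (h : ∀ i, |x i - y i| ≤ t) :
    |f x - f y| ≤ modCont f t := by
  apply le_csSup
  · refine ⟨M + M, ?_⟩
    rintro r ⟨x, y, hx, hy, -, rfl⟩
    exact (abs_sub _ _).trans (add_le_add (hM x hx) (hM y hy))
  · exact ⟨x, y, hx, hy, h, rfl⟩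

lemma mod_nonneg {d : ℕ} (f : (Fin d → ℝ) → ℝ) (t : ℝ) : 0 ≤ modCont f t := by
  apply Real.sSup_nonneg
  rintro r ⟨x, y, -, -, -, rfl⟩
  exact abs_nonneg _

lemma pow_bd (d : ℕ) {u : ℝ} (h0 : 0 ≤ u) (h1 : u ≤ 1) :
    (1 + u) ^ d - (1 - u) ^ d ≤ (d * 2 ^ d + d) * u := by
  have a : (1 + u) ^ d ≤ 1 + d * 2 ^ d * u := by
    induction d with
    | zero => simp
    | succ m ih =>
      rw [pow_succ, pow_succ]
      push_cast
      have p : (1:ℝ) ≤ 2 ^ m := one_le_pow₀ (by norm_num)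
      have q : (0:ℝ) ≤ m * 2 ^ m := by positivity
      calc (1 + u) ^ m * (1 + u) ≤ (1 + m * 2 ^ m * u) * (1 + u) := by gcongr
        _ = 1 + u * (1 + m * 2 ^ m + (m * 2 ^ m) * u) := by ring
        _ ≤ 1 + u * (1 + m * 2 ^ m + (m * 2 ^ m) * 1) := by gcongr
        _ ≤ 1 + u * ((m + 1) * (2 ^ m * 2)) := by gcongr; linarith
        _ = _ := by ring
  have b := one_add_mul_le_pow (show (-2:ℝ) ≤ -u by linarith) d
  rw [← sub_eq_add_neg] at b
  linarith

lemma bad_vol {d : ℕ} {Δ : Set (Fin d → ℝ)} (hconv : Convex ℝ Δ) (hcomp : IsCompact Δ)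
    {c : Fin d → ℝ} {r : ℝ} (hr : 0 < r) (hball : Metric.closedBall c r ⊆ Δ)
    {N : ℕ} (hN : 0 < N) (hNr : 1 / (N:ℝ) ≤ r) (B : Finset (Fin d → ℕ))
    (hB : ∀ k ∈ B, (gcube N k ∩ Δ).Nonempty ∧ ¬ gcube N k ⊆ Δ) :
    ∑ k ∈ B, (1 / (N:ℝ)) ^ d ≤
      (volume.real Δ * (d * 2 ^ d + d) / r) * (1 / N) := by
  have hN' : (0 : ℝ) < N := by exact_mod_cast hN
  set u : ℝ := 1 / N / r with hu
  have hu0 : 0 < u := by positivity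
  have hu1 : u ≤ 1 := by rw [hu, div_le_one hr]; exact hNr
  have hur : u * r = 1 / N := by rw [hu]; field_simp
  have hmem : ∀ (k : Fin d → ℕ) (y z : Fin d → ℝ), y ∈ gcube N k → z ∈ gcube N k →
      c + u⁻¹ • (y - z) ∈ Δ := by
    intro k y z hy hz
    apply hball
    rw [Metric.mem_closedBall, dist_eq_norm, add_sub_cancel_left, norm_smul, norm_inv,
      Real.norm_of_nonneg hu0.le, inv_mul_le_iff₀ hu0, hur, pi_norm_le_iff_of_nonneg (by positivity)]
    intro i
    exact gcube_dist hy hz i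
  set U : Set (Fin d → ℝ) := ⋃ k ∈ B, gcube N k with hU
  have hUm : MeasurableSet U := Finset.measurableSet_biUnion _ fun k _ => gcube_meas N k
  have hout : U ⊆ AffineMap.homothety c (1 + u) '' Δ := by
    intro q hq
    obtain ⟨k, hk, hq⟩ := Set.mem_iUnion₂.1 hq
    obtain ⟨⟨p, hp, hpΔ⟩, -⟩ := hB k hk
    have hw := hmem k q p hq hp
    have := hconv hpΔ hw (a := (1 + u)⁻¹) (b := (1 + u)⁻¹ * u) (by positivity) (by positivity)
      (by field_simp)
    refine ⟨_, this, ?_⟩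
    rw [AffineMap.homothety_apply]
    ext i
    simp
    field_simp
    ring
  have hin : Disjoint U (AffineMap.homothety c (1 - u) '' Δ) := by
    rw [Set.disjoint_left]
    rintro q hq ⟨z, hz, rfl⟩
    obtain ⟨k, hk, hq⟩ := Set.mem_iUnion₂.1 hq
    apply (hB k hk).2
    intro y hy
    have hw := hmem k y _ hy hq
    have := hconv hz hw (a := 1 - u) (b := u) (by linarith) (by positivity) (by ring)
    convert this using 1
    rw [AffineMap.homothety_apply]
    ext i
    simp
    field_simp
    ring
  have hsub2 : AffineMap.homothety c (1 - u) '' Δ ⊆ AffineMap.homothety c (1 + u) '' Δ := by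
    rintro _ ⟨z, hz, rfl⟩
    have hc : c ∈ Δ := hball (Metric.mem_closedBall_self hr.le)
    have := hconv hz hc (a := (1 + u)⁻¹ * (1 - u)) (b := (1 + u)⁻¹ * (2 * u))
      (mul_nonneg (by positivity) (by linarith)) (by positivity) (by field_simp; ring)
    refine ⟨_, this, ?_⟩
    rw [AffineMap.homothety_apply, AffineMap.homothety_apply]
    ext i
    simp
    field_simp
    ring
  have hvol : ∀ a : ℝ, 0 ≤ a → volume.real (AffineMap.homothety c a '' Δ) =
      a ^ d * volume.real Δ := by
    intro a ha
    rw [measureReal_def, Measure.addHaar_image_homothety, ENNReal.toReal_mul,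
      ENNReal.toReal_ofReal (abs_nonneg _), abs_of_nonneg (by positivity)]
    simp [measureReal_def]
  have hfin : ∀ a : ℝ, volume (AffineMap.homothety c a '' Δ) ≠ ⊤ := by
    intro a
    rw [Measure.addHaar_image_homothety]
    exact ENNReal.mul_ne_top ENNReal.ofReal_ne_top hcomp.measure_lt_top.ne
  have hUvol : volume.real U = ∑ k ∈ B, (1 / (N:ℝ)) ^ d := by
    rw [hU, measureReal_biUnion_finset (h := fun k _ => gcube_vol_ne_top N k)]
    · exact Finset.sum_congr rfl fun k _ => gcube_vol N k
    · intro k _ l _ hkl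
      exact gcube_disj hN hkl
    · intro k _; exact gcube_meas N k
  have h1 : volume.real U + volume.real (AffineMap.homothety c (1 - u) '' Δ) ≤
      volume.real (AffineMap.homothety c (1 + u) '' Δ) := by
    rw [← measureReal_union' hin hUm ((measure_mono hout).trans_lt (hfin _).lt_top).ne (hfin _)]
    exact measureReal_mono (Set.union_subset hout hsub2) (hfin _)
  rw [hvol _ (by linarith), hvol _ (by linarith), hUvol] at h1
  have h2 := pow_bd d hu0.le hu1
  have h3 : (0:ℝ) ≤ volume.real Δ := measureReal_nonneg
  have h4 : volume.real Δ * ((1 + u) ^ d - (1 - u) ^ d) ≤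
      volume.real Δ * ((d * 2 ^ d + d) * u) := by gcongr
  have h5 : volume.real Δ * ((d * 2 ^ d + d) * u) =
      (volume.real Δ * (d * 2 ^ d + d) / r) * (1 / N) := by rw [hu]; ring
  rw [← h5]
  linarith

lemma cube_est {d n N : ℕ} (hn : 0 < n) (hN : 0 < N) {Δ : Set (Fin d → ℝ)}
    (x : Fin n → (Fin d → ℝ)) (f : (Fin d → ℝ) → ℝ)
    (hf : ContinuousOn f (Set.pi Set.univ (fun _ => Set.Icc (0:ℝ) 1)))
    {M t : ℝ} (hM0 : 0 ≤ M)
    (hM : ∀ x ∈ Set.pi Set.univ (fun _ => Set.Icc (0:ℝ) 1), |f x| ≤ M)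
    (ht : 1 / (N:ℝ) ≤ t) {k : Fin d → ℕ} (hk : k ∈ gidx d N) (hD : 0 ≤ discrepancy x) :
    |(1 / (n : ℝ)) * ∑ j ∈ Finset.univ.filter (fun j => x j ∈ gcube N k ∧ x j ∈ Δ), f (x j) -
      ∫ y in gcube N k ∩ Δ, f y| ≤
    modCont f t * (2 * (1 / (N:ℝ)) ^ d + discrepancy x) + M * discrepancy x +
      if (gcube N k ∩ Δ).Nonempty ∧ ¬ gcube N k ⊆ Δ then 2 * M * (1 / (N:ℝ)) ^ d else 0 := by
  have hn' : (0 : ℝ) < n := by exact_mod_cast hn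
  have hN' : (0 : ℝ) < N := by exact_mod_cast hN
  have hρ := mod_nonneg f t
  set ρ := modCont f t with hρd
  set D := discrepancy x with hDd
  set v : ℝ := (1 / (N:ℝ)) ^ d with hv
  have hv0 : 0 ≤ v := by positivity
  have hvol : volume.real (gcube N k) = v := gcube_vol N k
  have hfin := gcube_vol_ne_top N k
  have hdc := disc_cube hn hN x hk
  set cnt : ℝ := ((Finset.univ.filter (fun j => x j ∈ gcube N k)).card : ℝ) with hcnt
  rw [← hv, ← hDd] at hdc
  have hcle : cnt / n ≤ v + D := by linarith [(le_abs_self _).trans hdc]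
  have hQ : gcube N k ⊆ Set.pi Set.univ (fun _ => Set.Icc (0:ℝ) 1) :=
    (gcube_sub hN hk).trans (Set.pi_mono fun _ _ => Set.Ico_subset_Icc_self)
  by_cases h1 : gcube N k ⊆ Δ
  · rw [if_neg (by tauto)]
    rw [Set.inter_eq_left.2 h1]
    have e : Finset.univ.filter (fun j => x j ∈ gcube N k ∧ x j ∈ Δ) =
        Finset.univ.filter (fun j => x j ∈ gcube N k) := by
      apply Finset.filter_congr
      intro j _
      exact ⟨fun h => h.1, fun h => ⟨h, h1 h⟩⟩
    rw [e]
    set c : Fin d → ℝ := fun i => (k i : ℝ) / N with hc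
    have hcQ : c ∈ gcube N k := fun i _ => ⟨le_rfl, (gidx_bd hN hk i).2.1⟩
    have hosc : ∀ y ∈ gcube N k, |f y - f c| ≤ ρ := fun y hy =>
      mod_le hM (hQ hy) (hQ hcQ) fun i => (gcube_dist hy hcQ i).trans ht
    have hint : IntegrableOn f (gcube N k) := by
      refine (ContinuousOn.integrableOn_compact ?_ hf).mono_set hQ
      exact isCompact_univ_pi fun _ => isCompact_Icc
    have A : |(∫ y in gcube N k, f y) - v * f c| ≤ ρ * v := by
      have e2 : (∫ y in gcube N k, f y) - v * f c = ∫ y in gcube N k, (f y - f c) := by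
        rw [integral_sub hint (integrableOn_const hfin), setIntegral_const, hvol, smul_eq_mul]
      rw [e2, ← hvol]
      exact norm_setIntegral_le_of_norm_le_const (f := fun y => f y - f c) hfin.lt_top hosc
    have Bd : |(1 / (n : ℝ)) * ∑ j ∈ Finset.univ.filter (fun j => x j ∈ gcube N k), f (x j) -
        f c * (cnt / n)| ≤ ρ * (cnt / n) := by
      have e3 : (1 / (n : ℝ)) * ∑ j ∈ Finset.univ.filter (fun j => x j ∈ gcube N k), f (x j) -
        f c * (cnt / n) = (1 / (n:ℝ)) *
          ∑ j ∈ Finset.univ.filter (fun j => x j ∈ gcube N k), (f (x j) - f c) := by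
        rw [Finset.sum_sub_distrib, Finset.sum_const, nsmul_eq_mul]
        ring
      rw [e3, abs_mul, abs_of_pos (by positivity)]
      have : |∑ j ∈ Finset.univ.filter (fun j => x j ∈ gcube N k), (f (x j) - f c)| ≤
          cnt * ρ := by
        refine (Finset.abs_sum_le_sum_abs _ _).trans ?_
        rw [hcnt, ← nsmul_eq_mul]
        apply Finset.sum_le_card_nsmul
        intro j hj
        exact hosc _ (Finset.mem_filter.1 hj).2
      calc _ ≤ 1 / (n:ℝ) * (cnt * ρ) := by gcongr
        _ = _ := by ring
    have Cd : |f c * (cnt / n - v)| ≤ M * D := by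
      rw [abs_mul]
      exact mul_le_mul (hM c (hQ hcQ)) hdc (abs_nonneg _) hM0
    have h5 : ρ * (cnt / n) ≤ ρ * (v + D) := by gcongr
    rw [abs_le] at *
    constructor <;> nlinarith
  · by_cases h2 : (gcube N k ∩ Δ).Nonempty
    · rw [if_pos ⟨h2, h1⟩]
      have A : |∫ y in gcube N k ∩ Δ, f y| ≤ M * v := by
        have := norm_setIntegral_le_of_norm_le_const (μ := volume) (f := f)
          (s := gcube N k ∩ Δ) (C := M)
          ((measure_mono Set.inter_subset_left).trans_lt hfin.lt_top)
          (fun y hy => hM y (hQ hy.1))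
        refine this.trans ?_
        rw [← hvol]
        exact mul_le_mul_of_nonneg_left (measureReal_mono Set.inter_subset_left hfin) hM0
      have Bd : |(1 / (n : ℝ)) *
          ∑ j ∈ Finset.univ.filter (fun j => x j ∈ gcube N k ∧ x j ∈ Δ), f (x j)| ≤
          M * (cnt / n) := by
        rw [abs_mul, abs_of_pos (by positivity)]
        have : |∑ j ∈ Finset.univ.filter (fun j => x j ∈ gcube N k ∧ x j ∈ Δ), f (x j)| ≤
          cnt * M := by
          refine (Finset.abs_sum_le_sum_abs _ _).trans ?_
          refine (Finset.sum_le_sum_of_subset_of_nonneg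
            (t := Finset.univ.filter (fun j => x j ∈ gcube N k)) ?_ ?_).trans ?_
          · intro j hj
            rw [Finset.mem_filter] at *
            exact ⟨hj.1, hj.2.1⟩
          · intros; exact abs_nonneg _
          rw [hcnt, ← nsmul_eq_mul]
          apply Finset.sum_le_card_nsmul
          intro j hj
          exact hM _ (hQ (Finset.mem_filter.1 hj).2)
        calc _ ≤ 1 / (n:ℝ) * (cnt * M) := by gcongr
          _ = _ := by ring
      have h5 : M * (cnt / n) ≤ M * (v + D) := by gcongr
      have h6 : 0 ≤ ρ * (2 * v + D) := by positivity
      rw [abs_le] at *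
      constructor <;> nlinarith
    · rw [if_neg (by tauto)]
      rw [Set.not_nonempty_iff_eq_empty] at h2
      have e : Finset.univ.filter (fun j => x j ∈ gcube N k ∧ x j ∈ Δ) = ∅ := by
        rw [Finset.filter_eq_empty_iff]
        intro j _ hj
        have : x j ∈ gcube N k ∩ Δ := hj
        rw [h2] at this
        exact this
      rw [e, h2]
      simp
      positivity

lemma sum_split {d n N : ℕ} (hN : 0 < N) {Δ : Set (Fin d → ℝ)}
    (x : Fin n → (Fin d → ℝ)) (f : (Fin d → ℝ) → ℝ)
    (hx : ∀ j, x j ∈ Set.pi Set.univ (fun _ => Set.Ico (0:ℝ) 1)) :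
    ∑ j ∈ Finset.univ.filter (fun j => x j ∈ Δ), f (x j) =
      ∑ k ∈ gidx d N,
        ∑ j ∈ Finset.univ.filter (fun j => x j ∈ gcube N k ∧ x j ∈ Δ), f (x j) := by
  rw [← Finset.sum_fiberwise_of_maps_to
    (s := Finset.univ.filter (fun j => x j ∈ Δ)) (t := gidx d N)
    (g := fun j => fun i => ⌊(N : ℝ) * x j i⌋₊)
    (fun j _ => (gcube_mem_floor hN (hx j)).2)]
  apply Finset.sum_congr rfl
  intro k _
  apply Finset.sum_congr _ fun _ _ => rfl
  ext j
  simp only [Finset.mem_filter, Finset.mem_univ, true_and]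
  constructor
  · rintro ⟨h1, rfl⟩
    exact ⟨(gcube_mem_floor hN (hx j)).1, h1⟩
  · rintro ⟨h1, h2⟩
    exact ⟨h2, gcube_floor hN h1⟩

lemma int_split {d N : ℕ} (hN : 0 < N) {Δ : Set (Fin d → ℝ)} (hΔ : MeasurableSet Δ)
    (hsub : Δ ⊆ Set.pi Set.univ (fun _ => Set.Icc (0:ℝ) 1)) (f : (Fin d → ℝ) → ℝ)
    (hf : ContinuousOn f (Set.pi Set.univ (fun _ => Set.Icc (0:ℝ) 1))) :
    ∫ y in Δ, f y = ∑ k ∈ gidx d N, ∫ y in gcube N k ∩ Δ, f y := by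
  rw [← integral_biUnion_finset]
  · rw [← Set.iUnion₂_inter, gcube_union hN]
    apply setIntegral_congr_set
    have : (Set.pi Set.univ (fun _ : Fin d => Set.Ico (0:ℝ) 1) : Set (Fin d → ℝ))
        =ᵐ[volume] Set.pi Set.univ (fun _ => Set.Icc (0:ℝ) 1) := by
      have := Measure.univ_pi_Ico_ae_eq_Icc (μ := fun _ : Fin d => (volume : Measure ℝ))
        (f := fun _ => 0) (g := fun _ => 1)
      rw [← Set.pi_univ_Icc] at this
      exact this
    have h2 := this.inter (Filter.EventuallyEq.refl _ Δ)
    rw [Set.inter_eq_right.2 hsub] at h2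
    exact h2.symm
  · intro k _; exact (gcube_meas N k).inter hΔ
  · intro k _ l _ hkl
    exact (gcube_disj hN hkl).mono Set.inter_subset_left Set.inter_subset_left
  · intro k _
    refine (ContinuousOn.integrableOn_compact ?_ hf).mono_set (Set.inter_subset_right.trans hsub)
    exact isCompact_univ_pi fun _ => isCompact_Icc

theorem koksma_inequality_over_polytopes
    (d : ℕ) (hd : 1 ≤ d) (Δ : Set (Fin d → ℝ))
    (hpoly : ∃ S : Finset (Fin d → ℝ), S.Nonempty ∧ Δ = convexHull ℝ (S : Set (Fin d → ℝ)))
    (hdim : (interior Δ).Nonempty)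
    (hsub : Δ ⊆ Set.pi Set.univ (fun _ => Set.Icc (0:ℝ) 1)) :
    ∃ C D₀ : ℝ, 0 < C ∧ 0 < D₀ ∧
      ∀ (f : (Fin d → ℝ) → ℝ),
        ContinuousOn f (Set.pi Set.univ (fun _ => Set.Icc (0:ℝ) 1)) →
        ∀ M : ℝ, 0 ≤ M →
          (∀ x ∈ Set.pi Set.univ (fun _ => Set.Icc (0:ℝ) 1), |f x| ≤ M) →
          ∀ (n : ℕ), 0 < n → ∀ (x : Fin n → (Fin d → ℝ)),
            (∀ j, x j ∈ Set.pi Set.univ (fun _ => Set.Ico (0:ℝ) 1)) →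
            discrepancy x ≤ D₀ →
            |(1 / (n : ℝ)) * ∑ j ∈ Finset.univ.filter (fun j => x j ∈ Δ), f (x j) -
                ∫ y in Δ, f y| ≤
              C * (modCont f ((discrepancy x) ^ ((1 : ℝ) / (d + 1))) +
                M * (discrepancy x) ^ ((1 : ℝ) / (2 * d + 2))) := by
  obtain ⟨S, -, hS⟩ := hpoly
  have hconv : Convex ℝ Δ := hS ▸ convex_convexHull ℝ _
  have hcomp : IsCompact Δ := hS ▸ S.finite_toSet.isCompact_convexHull ℝ
  obtain ⟨c, hc⟩ := hdim
  obtain ⟨r, hr, hball⟩ := Metric.nhds_basis_closedBall.mem_iff.1 (mem_interior_iff_mem_nhds.1 hc)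
  set K : ℝ := volume.real Δ * (d * 2 ^ d + d) / r with hK
  have hK0 : 0 ≤ K := by positivity
  refine ⟨2 + 2 ^ d + 2 * K, min 1 (r ^ (d + 1)), by positivity, by positivity, ?_⟩
  intro f hf M hM0 hM n hn x hx hDle
  have hD := disc_pos hd hn x hx
  set D := discrepancy x with hDd
  have hD1 : D ≤ 1 := hDle.trans (min_le_left _ _)
  set t : ℝ := D ^ ((1 : ℝ) / (d + 1)) with ht
  have ht0 : 0 < t := Real.rpow_pos_of_pos hD _
  have ht1 : t ≤ 1 := Real.rpow_le_one hD.le hD1 (by positivity)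
  have htpow : t ^ (d + 1) = D := by
    rw [ht, ← Real.rpow_natCast, ← Real.rpow_mul hD.le]
    have : (1:ℝ) / (d + 1) * ((d + 1 : ℕ) : ℝ) = 1 := by push_cast; field_simp
    rw [this, Real.rpow_one]
  have htr : t ≤ r := by
    have : t ^ (d + 1) ≤ r ^ (d + 1) := by rw [htpow]; exact hDle.trans (min_le_right _ _)
    exact le_of_pow_le_pow_left₀ (by omega) hr.le this
  have htt : t ≤ D ^ ((1 : ℝ) / (2 * d + 2)) := by
    apply Real.rpow_le_rpow_of_exponent_ge hD hD1
    gcongr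
    · linarith
    · norm_num
  set N := ⌈1 / t⌉₊ with hNd
  have hN : 0 < N := Nat.ceil_pos.2 (by positivity)
  have hN' : (0 : ℝ) < N := by exact_mod_cast hN
  have hNt : 1 / (N:ℝ) ≤ t := by
    rw [one_div_le hN' ht0]; exact Nat.le_ceil _
  have hNle : (N:ℝ) ≤ 2 / t := by
    have h1 := (Nat.ceil_lt_add_one (show 0 ≤ 1 / t by positivity)).le
    have h2 : 1 ≤ 1 / t := by rw [le_div_iff₀ ht0]; linarith
    calc (N:ℝ) ≤ 1 / t + 1 := h1
      _ ≤ 1 / t + 1 / t := by linarith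
      _ = 2 / t := by ring
  have hND : (N:ℝ) ^ d * D ≤ 2 ^ d * t := by
    calc (N:ℝ) ^ d * D ≤ (2 / t) ^ d * D := by gcongr
      _ = 2 ^ d * t := by rw [← htpow, div_pow, pow_succ]; field_simp
  have hNv : (N:ℝ) ^ d * (1 / (N:ℝ)) ^ d = 1 := by
    rw [← mul_pow, mul_one_div_cancel hN'.ne', one_pow]
  rw [sum_split hN x f hx, int_split hN hcomp.measurableSet hsub f hf, Finset.mul_sum,
    ← Finset.sum_sub_distrib]
  refine (Finset.abs_sum_le_sum_abs _ _).trans ?_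
  refine (Finset.sum_le_sum fun k hk => cube_est hn hN x f hf hM0 hM hNt hk hD.le).trans ?_
  rw [Finset.sum_add_distrib, Finset.sum_const, gidx_card, nsmul_eq_mul, ← Finset.sum_filter]
  have hbad := bad_vol hconv hcomp hr hball hN (hNt.trans htr)
    ((gidx d N).filter fun k => (gcube N k ∩ Δ).Nonempty ∧ ¬ gcube N k ⊆ Δ)
    (fun k hk => (Finset.mem_filter.1 hk).2)
  rw [← Finset.mul_sum]
  set V := ∑ k ∈ (gidx d N).filter (fun k => (gcube N k ∩ Δ).Nonempty ∧ ¬ gcube N k ⊆ Δ),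
    (1 / (N:ℝ)) ^ d with hV
  rw [← hK] at hbad
  have hV2 : V ≤ K * t := hbad.trans (by gcongr)
  have hρ := mod_nonneg f t
  rw [← hDd]
  set ρ := modCont f t
  set T := D ^ ((1 : ℝ) / (2 * d + 2)) with hT
  push_cast
  calc (N:ℝ) ^ d * (ρ * (2 * (1 / (N:ℝ)) ^ d + D) + M * D) + 2 * M * V
      = ρ * (2 * ((N:ℝ) ^ d * (1 / (N:ℝ)) ^ d) + (N:ℝ) ^ d * D) + M * ((N:ℝ) ^ d * D)
        + 2 * M * V := by ring
    _ ≤ ρ * (2 * 1 + 2 ^ d * t) + M * (2 ^ d * t) + 2 * M * (K * t) := by rw [hNv]; gcongr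
    _ ≤ ρ * (2 * 1 + 2 ^ d * 1) + M * (2 ^ d * T) + 2 * M * (K * T) := by gcongr
    _ = (2 + 2 ^ d) * ρ + (2 ^ d + 2 * K) * (M * T) := by ring
    _ ≤ (2 + 2 ^ d + 2 * K) * ρ + (2 + 2 ^ d + 2 * K) * (M * T) := by
        have : 0 ≤ M * T := mul_nonneg hM0 (ht0.le.trans htt)
        exact add_le_add (mul_le_mul_of_nonneg_right (by linarith) hρ)
          (mul_le_mul_of_nonneg_right (by linarith) this)
    _ = _ := by ring
end

section
/- Let d ≥ 1 and let a = (a₁,…,a_d) ∈ ℤ^d be a nonzero primitive vector, i.e. the greatest common divisor of a₁,…,a_d equals 1. Then there exists a d×d integer matrix A with determinant ±1 (i.e. A ∈ GL_d(ℤ)) whose first column equals a and such that |A| ≤ 2^{max(0, d−2)} · |a|, where |A| = max_{i,j} |A_{ij}| and |a| = max_i |a_i|. -/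
lemma bez_aux (g c : ℤ) (h : IsCoprime g c) :
    ∃ x y : ℤ, g * y - x * c = 1 ∧ |x| ≤ max 1 |g| ∧ |y| ≤ max 1 |c| := by
  by_cases hg : g = 0
  · subst hg
    have hc : IsUnit c := isCoprime_zero_left.mp h
    refine ⟨-c, 0, ?_, ?_, by simp⟩
    · rcases Int.isUnit_iff.mp hc with rfl | rfl <;> norm_num
    · rcases Int.isUnit_iff.mp hc with rfl | rfl <;> norm_num
  · obtain ⟨u, v, huv⟩ := h
    have hgpos : 0 < |g| := abs_pos.mpr hg
    have h0 := Int.emod_nonneg (-v) hg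
    have h1 := Int.emod_lt_abs (-v) hg
    have h2 := Int.emod_add_mul_ediv (-v) g
    set x := (-v) % g
    set q := (-v) / g
    have hxy : g * (u - q * c) - x * c = 1 := by
      have : x = -v - g * q := by linarith
      rw [this]; linear_combination huv
    refine ⟨x, u - q * c, hxy, ?_, ?_⟩
    · rw [abs_of_nonneg h0]; exact le_max_of_le_right h1.le
    · set y := u - q * c
      have e : g * y = 1 + x * c := by linarith
      have e2 : |g| * |y| ≤ 1 + x * |c| := by
        rw [← abs_mul, e]
        refine (abs_add_le _ _).trans ?_
        rw [abs_mul, abs_of_nonneg h0]; simp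
      have m1 := le_max_left 1 |c|
      have m2 := le_max_right 1 |c|
      set m := max 1 |c|
      have e3 : x * |c| ≤ (|g| - 1) * m :=
        mul_le_mul (by omega) m2 (abs_nonneg _) (by omega)
      have : |g| * |y| ≤ |g| * m := by nlinarith
      exact le_of_mul_le_mul_left this hgpos

lemma extract_aux (n : ℕ) (a : Fin (n+1) → ℤ) (M : ℤ) (hM : 1 ≤ M) (h : ∀ i, |a i| ≤ M) :
    ∃ b : Fin (n+1) → ℤ, (∀ i, a i = Finset.univ.gcd a * b i) ∧ Finset.univ.gcd b = 1 ∧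
      ∀ i, max 1 |Finset.univ.gcd a| * |b i| ≤ M := by
  by_cases hg : Finset.univ.gcd a = 0
  · refine ⟨Pi.single 0 1, ?_, ?_, ?_⟩
    · intro i
      rw [hg, zero_mul]
      exact Finset.gcd_eq_zero_iff.mp hg i (Finset.mem_univ _)
    · have h1 : Finset.univ.gcd (Pi.single 0 1 : Fin (n+1) → ℤ) ∣ 1 := by
        have := Finset.gcd_dvd (f := (Pi.single 0 1 : Fin (n+1) → ℤ)) (Finset.mem_univ 0)
        simpa using this
      rw [← Finset.normalize_gcd]
      exact normalize_eq_one.mpr (isUnit_of_dvd_one h1)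
    · intro i
      rw [hg]
      by_cases hi : i = 0
      · subst hi; simpa using hM
      · simp [Pi.single_apply, hi]; omega
  · obtain ⟨b, hb, hb1⟩ := Finset.extract_gcd a (Finset.univ_nonempty (α := Fin (n+1)))
    refine ⟨b, fun i => hb i (Finset.mem_univ _), hb1, fun i => ?_⟩
    have : 0 < |Finset.univ.gcd a| := abs_pos.mpr hg
    rw [max_eq_right (by omega), ← abs_mul, ← hb i (Finset.mem_univ _)]
    exact h i

lemma main_aux (n : ℕ) : ∀ (a : Fin (n+1) → ℤ) (M : ℤ), 1 ≤ M → (∀ i, |a i| ≤ M) →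
    Finset.univ.gcd a = 1 →
    ∃ A : Matrix (Fin (n+1)) (Fin (n+1)) ℤ, IsUnit A.det ∧ (∀ i, A i 0 = a i) ∧
      ∀ i j, |A i j| ≤ M := by
  induction n with
  | zero =>
    intro a M hM h hg
    refine ⟨fun i _ => a i, ?_, fun _ => rfl, fun i _ => h i⟩
    have h1 : a 0 ∣ Finset.univ.gcd a := by
      refine Finset.dvd_gcd fun i _ => ?_
      have hi : i = 0 := by ext; have := i.isLt; simp
      rw [hi]
    rw [hg] at h1
    have hdet : Matrix.det (fun (i : Fin (0+1)) (_ : Fin (0+1)) => a i) = a 0 :=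
      Matrix.det_fin_one (A := fun (i _ : Fin 1) => a i)
    rw [hdet]
    exact isUnit_of_dvd_one h1
  | succ n ih =>
    intro a M hM h hgcd
    obtain ⟨b, hb, hb1, hbM⟩ := extract_aux n (fun i => a i.succ) M hM (fun i => h _)
    set g := Finset.univ.gcd (fun i : Fin (n+1) => a i.succ) with hgdef
    have hcop : IsCoprime g (a 0) := by
      rw [← gcd_isUnit_iff]
      apply isUnit_of_dvd_one
      rw [← hgcd]
      refine Finset.dvd_gcd fun i _ => ?_
      refine Fin.cases ?_ (fun i => ?_) i
      · exact gcd_dvd_right _ _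
      · rw [hb i]; exact (gcd_dvd_left _ _).mul_right _
    obtain ⟨x, y, hxy, hx, hy⟩ := bez_aux g (a 0) hcop
    have hbM' : ∀ i, |b i| ≤ M := fun i => by
      have := hbM i
      have h1 := le_max_left 1 |g|
      nlinarith [abs_nonneg (b i)]
    obtain ⟨B, hB, hB0, hBM⟩ := ih b M hM hbM' hb1
    let A : Matrix (Fin (n+2)) (Fin (n+2)) ℤ := Matrix.of
      (Fin.cons (Fin.cons (a 0) (Fin.cons y 0))
        (fun i => Fin.cons (a i.succ) (Fin.cons (x * b i) (fun j => B i j.succ))))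
    refine ⟨A, ?_, ?_, ?_⟩
    · have key : ∀ t : ℤ, (B.updateCol 0 (t • fun i => B i 0)).det = t * B.det := by
        intro t
        rw [Matrix.det_updateCol_smul]
        congr 2
        ext i j
        by_cases hj : j = 0
        · subst hj; simp
        · simp [Matrix.updateCol_ne hj]
      have s0 : A.submatrix Fin.succ (Fin.succAbove 0) =
          B.updateCol 0 (x • fun i => B i 0) := by
        ext i j
        refine Fin.cases ?_ (fun j => ?_) j
        · simp [A, hB0]
        · simp [A, Matrix.updateCol_apply]
      have s1 : A.submatrix Fin.succ (Fin.succAbove 1) =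
          B.updateCol 0 (g • fun i => B i 0) := by
        ext i j
        refine Fin.cases ?_ (fun j => ?_) j
        · simp [A, hB0]; exact hb i
        · have : (1 : Fin (n+2)).succAbove j.succ = j.succ.succ := by
            rw [← Fin.succ_zero_eq_one, Fin.succ_succAbove_succ]; simp
          simp [A, Matrix.updateCol_apply, this]
      have : A.det = - B.det := by
        rw [Matrix.det_succ_row_zero, Fin.sum_univ_succ, Fin.sum_univ_succ,
          Fin.succ_zero_eq_one, s0, s1, key, key]
        simp [A, Fin.succ_ne_zero]
        have e1 : (Fin.cons (a 0) (Fin.cons y 0 : Fin (n+1) → ℤ) : Fin (n+2) → ℤ) 1 = y := rfl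
        try rw [e1]
        linear_combination (-B.det) * hxy
      rw [this]; exact hB.neg
    · intro i
      refine Fin.cases ?_ (fun i => ?_) i <;> simp [A]
    · intro i j
      refine Fin.cases ?_ (fun i => ?_) i
      · refine Fin.cases ?_ (fun j => ?_) j
        · simpa [A] using h 0
        · refine Fin.cases ?_ (fun j => ?_) j
          · simpa [A] using hy.trans (max_le hM (h 0))
          · simp [A]; omega
      · refine Fin.cases ?_ (fun j => ?_) j
        · simpa [A] using h i.succ
        · refine Fin.cases ?_ (fun j => ?_) j
          · have : |x * b i| ≤ M := by
              rw [abs_mul]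
              exact (mul_le_mul_of_nonneg_right hx (abs_nonneg _)).trans (hbM i)
            simpa [A] using this
          · simpa [A] using hBM i j.succ

/-- Every nonzero primitive vector `a ∈ ℤ^d` (i.e. `gcd(a₁,…,a_d) = 1`) is the first
column of a matrix `A ∈ GL_d(ℤ)` with `|A| ≤ 2^{max(0,d−2)} · |a|`. -/
theorem primitive_vector_extends_to_GL_int
    (d : ℕ) (hd : 1 ≤ d) (a : Fin d → ℤ) (ha : a ≠ 0)
    (hgcd : Finset.univ.gcd a = 1) :
    ∃ A : Matrix (Fin d) (Fin d) ℤ, IsUnit A.det ∧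
      (∀ i, A i ⟨0, hd⟩ = a i) ∧
      ∀ i j, (A i j).natAbs ≤ 2 ^ (d - 2) * Finset.univ.sup (fun i => (a i).natAbs) := by
  obtain ⟨n, rfl⟩ : ∃ n, d = n + 1 := ⟨d - 1, by omega⟩
  set S := Finset.univ.sup (fun i => (a i).natAbs) with hS
  have hle : ∀ i, (a i).natAbs ≤ S := fun i =>
    Finset.le_sup (f := fun i => (a i).natAbs) (Finset.mem_univ i)
  obtain ⟨k, hk⟩ := Function.ne_iff.mp ha
  have hk' : a k ≠ 0 := hk
  have hS1 : 1 ≤ S := by have := hle k; omega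
  obtain ⟨A, h1, h2, h3⟩ := main_aux n a S (by exact_mod_cast hS1)
    (fun i => by have := hle i; rw [Int.abs_eq_natAbs]; exact_mod_cast this) hgcd
  refine ⟨A, h1, h2, fun i j => ?_⟩
  have h4 : (A i j).natAbs ≤ S := by have := h3 i j; rw [Int.abs_eq_natAbs] at this; exact_mod_cast this
  exact h4.trans (Nat.le_mul_of_pos_left _ (by positivity))
end

section
/- Let d ≥ 1 be an integer. There exists a constant C > 0 depending only on d such that for every torsion point ω = (ω₁,…,ω_d) ∈ (ℂ*)^d of order m, the finite sequence of argument vectors (x_k)_{k ∈ (ℤ/mℤ)ˣ} in [0,1)^d of the Galois conjugates of ω (so n = φ(m) points in total) satisfies D(x₁,…,x_n) ≤ C · (log(2δ(ω)))^{d−1} · log log(3δ(ω)) / δ(ω)^{1/2}, where δ(ω) is the strictness degree of ω and D is the discrepancy. -/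
open MeasureTheory Finset
open scoped Classical

/-- The strictness degree of a point `ω ∈ (ℂ*)^d`: the least value of `max_i |a_i|`
over nonzero integer vectors `a` with `ω₁^{a₁} ⋯ ω_d^{a_d} = 1`. -/
noncomputable def strictDeg {d : ℕ} (ω : Fin d → ℂ) : ℕ :=
  sInf {n | ∃ a : Fin d → ℤ, a ≠ 0 ∧ (∏ i, ω i ^ a i) = 1 ∧
    Finset.univ.sup (fun i => (a i).natAbs) = n}

/-- The argument vector in `[0,1)^d` of a point of `(S¹)^d`. -/
noncomputable def argVec {d : ℕ} (z : Fin d → ℂ) : Fin d → ℝ :=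
  fun i => Int.fract ((z i).arg / (2 * Real.pi))

/-- The discrepancy of a finite family `(x_j)_{j ∈ s}` of points of `[0,1)^d`:
`sup_B | #{j ∈ s : x_j ∈ B}/#s − vol(B) |` over boxes `B = ∏ [a_i, b_i)` with
`0 ≤ a_i < b_i ≤ 1`. -/
noncomputable def discrepancyOn {d : ℕ} {ι : Type*} (s : Finset ι)
    (x : ι → (Fin d → ℝ)) : ℝ :=
  sSup {r | ∃ a b : Fin d → ℝ, (∀ i, 0 ≤ a i ∧ a i < b i ∧ b i ≤ 1) ∧
    r = |((s.filter (fun j => ∀ i, a i ≤ x j i ∧ x j i < b i)).card : ℝ) / s.card -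
      ∏ i, (b i - a i)|}


lemma NT_primeSum (N : ℕ) (hN : 2 ≤ N) :
    ∑ p ∈ (Finset.Icc 1 N).filter Nat.Prime, (1 / p : ℝ)
      - (∑ p ∈ (Finset.Icc 1 N).filter Nat.Prime, Real.log p) / (N * Real.log N)
    ≤ Real.log 4 * (Real.log (Real.log N) - 1 / Real.log N + 2) := by
  induction N, hN using Nat.le_induction with
  | base =>
    have h : (Finset.Icc 1 2).filter Nat.Prime = {2} := by decide
    have hl := Real.log_two_gt_d9
    have hl' := Real.log_two_lt_d9
    rw [h]
    have h0 : (1:ℝ) / (2:ℕ) - Real.log (2:ℕ) / ((2:ℕ) * Real.log (2:ℕ)) = 0 := by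
      push_cast; field_simp; ring
    simp only [Finset.sum_singleton]
    rw [h0]
    apply mul_nonneg (Real.log_nonneg (by norm_num))
    push_cast
    have h1 : 1 / Real.log 2 ≤ 1.45 := by
      rw [div_le_iff₀ (by linarith)]; linarith
    have h2 : 1 - (Real.log 2)⁻¹ ≤ Real.log (Real.log 2) := Real.one_sub_inv_le_log_of_pos (by linarith)
    rw [← one_div] at h2
    have h3 : -0.5 ≤ Real.log (Real.log 2) := by linarith
    linarith
  | succ N hN ih =>
    have hN' : (2:ℝ) ≤ N := by exact_mod_cast hN
    have hv : 0 < Real.log N := Real.log_pos (by linarith)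
    have hu : 0 < Real.log ((N:ℝ)+1) := Real.log_pos (by linarith)
    set v := Real.log N with hvdef
    set u := Real.log ((N:ℝ)+1) with hudef
    set th := ∑ p ∈ (Finset.Icc 1 N).filter Nat.Prime, Real.log p with hth
    set S := ∑ p ∈ (Finset.Icc 1 N).filter Nat.Prime, (1 / p : ℝ) with hS
    have hthle : th ≤ Real.log 4 * N := by
      have := Chebyshev.theta_le_log4_mul_x (x := (N:ℝ)) (by positivity)
      rw [Chebyshev.theta_eq_sum_Icc] at this
      refine le_trans (le_of_eq ?_) this
      rw [hth, Nat.floor_natCast]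
      apply Finset.sum_congr _ (fun _ _ => rfl)
      ext p
      simp only [Finset.mem_filter, Finset.mem_Icc]
      constructor
      · rintro ⟨⟨a, b⟩, c⟩; exact ⟨⟨by omega, b⟩, c⟩
      · rintro ⟨⟨a, b⟩, c⟩; exact ⟨⟨c.one_lt.le, b⟩, c⟩
    have key : ∑ p ∈ (Finset.Icc 1 (N+1)).filter Nat.Prime, (1 / p : ℝ)
      - (∑ p ∈ (Finset.Icc 1 (N+1)).filter Nat.Prime, Real.log p) / ((N+1:ℕ) * Real.log (N+1:ℕ))
      = S - th / ((N+1) * u) := by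
      have hI : Finset.Icc 1 (N+1) = insert (N+1) (Finset.Icc 1 N) := by
        ext x; simp only [Finset.mem_Icc, Finset.mem_insert]; omega
      rw [hI, Finset.filter_insert]
      split_ifs with hp
      · rw [Finset.sum_insert (by simp), Finset.sum_insert (by simp)]
        push_cast
        rw [← hudef, ← hS, ← hth]
        field_simp
        ring
      · push_cast; rfl
    rw [key]
    push_cast
    rw [← hudef]
    have h1 : 1 / (N * v) - 1 / ((N+1) * u) ≥ 0 := by
      rw [ge_iff_le, sub_nonneg]
      apply one_div_le_one_div_of_le (by positivity)
      apply mul_le_mul (by linarith) _ hv.le (by linarith)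
      exact Real.log_le_log (by linarith) (by linarith)
    have h2 : S - th / ((N+1) * u) = (S - th / (N * v)) + th * (1 / (N * v) - 1 / ((N+1) * u)) := by
      ring
    rw [h2]
    have h3 : th * (1 / (N * v) - 1 / ((N+1) * u)) ≤ Real.log 4 * N * (1 / (N * v) - 1 / ((N+1) * u)) :=
      mul_le_mul_of_nonneg_right hthle h1
    have h4 : Real.log 4 * N * (1 / (N * v) - 1 / ((N+1) * u))
       = Real.log 4 * (1 / v - 1 / u + 1 / ((N+1) * u)) := by
      field_simp
      ring
    have h5 : 1 / ((N+1) * u) ≤ Real.log u - Real.log v := by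
      rw [← Real.log_div hu.ne' hv.ne']
      have a1 := Real.one_sub_inv_le_log_of_pos (x := u / v) (by positivity)
      refine le_trans ?_ a1
      have a2 := Real.one_sub_inv_le_log_of_pos (x := ((N:ℝ)+1) / N) (by positivity)
      rw [Real.log_div (by positivity) (by positivity)] at a2
      have a3 : 1 - (((N:ℝ)+1) / N)⁻¹ = 1 / (N+1) := by field_simp; ring
      rw [a3] at a2
      have a4 : 1 - (u/v)⁻¹ = (u - v) / u := by field_simp
      rw [a4, ← div_div]
      gcongr
    have h6 : 0 ≤ Real.log 4 := Real.log_nonneg (by norm_num)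
    nlinarith [mul_le_mul_of_nonneg_left h5 h6]

lemma NT_primeSum' (N : ℕ) (hN : 2 ≤ N) :
    ∑ p ∈ (Finset.Icc 1 N).filter Nat.Prime, (1 / p : ℝ) ≤
      Real.log 4 * (Real.log (Real.log N) + 2) := by
  have h := NT_primeSum N hN
  have hN' : (2:ℝ) ≤ N := by exact_mod_cast hN
  have hv : 0 < Real.log N := Real.log_pos (by linarith)
  have hthle : ∑ p ∈ (Finset.Icc 1 N).filter Nat.Prime, Real.log p ≤ Real.log 4 * N := by
    have := Chebyshev.theta_le_log4_mul_x (x := (N:ℝ)) (by positivity)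
    rw [Chebyshev.theta_eq_sum_Icc] at this
    refine le_trans (le_of_eq ?_) this
    rw [Nat.floor_natCast]
    apply Finset.sum_congr _ (fun _ _ => rfl)
    ext p
    simp only [Finset.mem_filter, Finset.mem_Icc]
    constructor
    · rintro ⟨⟨a, b⟩, c⟩; exact ⟨⟨by omega, b⟩, c⟩
    · rintro ⟨⟨a, b⟩, c⟩; exact ⟨⟨c.one_lt.le, b⟩, c⟩
  have h2 : (∑ p ∈ (Finset.Icc 1 N).filter Nat.Prime, Real.log p) / (N * Real.log N)
      ≤ Real.log 4 * (1 / Real.log N) := by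
    rw [div_le_iff₀ (by positivity)]
    refine hthle.trans (le_of_eq ?_)
    field_simp
  linarith

lemma NT_sumTele (s : Finset ℕ) (hs : ∀ p ∈ s, 2 ≤ p) :
    ∑ p ∈ s, (1 / ((p:ℝ) * (p - 1))) ≤ 1 := by
  have hsub : s ⊆ Finset.Ico 2 (s.sup id + 2) := by
    intro p hp
    rw [Finset.mem_Ico]
    have : p ≤ s.sup id := Finset.le_sup (f := id) hp
    exact ⟨hs p hp, by omega⟩
  have hT : ∀ N : ℕ, ∑ p ∈ Finset.Ico 2 (N + 2), (1 / ((p:ℝ) * (p - 1))) = 1 - 1 / (N + 1) := by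
    intro N
    induction N with
    | zero => simp
    | succ N ih =>
      rw [show N + 1 + 2 = (N + 2) + 1 by ring, Finset.sum_Ico_succ_top (by omega), ih]
      push_cast
      rw [show (N:ℝ) + 2 - 1 = N + 1 by ring]
      field_simp
      ring
  refine (Finset.sum_le_sum_of_subset_of_nonneg hsub ?_).trans ?_
  · intro i hi _
    have : (2:ℝ) ≤ i := by exact_mod_cast (Finset.mem_Ico.1 hi).1
    have : 0 ≤ (i:ℝ) - 1 := by linarith
    positivity
  · rw [hT]
    have : (0:ℝ) ≤ 1 / ((s.sup id : ℕ) + 1) := by positivity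
    linarith

lemma NT_log3 (x : ℝ) (hx : 1 ≤ x) : 1 ≤ Real.log (3 * x) := by
  rw [Real.le_log_iff_exp_le (by linarith)]
  have := Real.exp_one_lt_d9
  linarith

lemma NT_totient : ∃ K : ℝ, 0 < K ∧ ∀ n : ℕ, 0 < n →
    (n : ℝ) ≤ K * (n.totient : ℝ) * (1 + Real.log (Real.log (3 * n))) ^ 2 := by
  refine ⟨Real.exp (2 * Real.log 4 + 3) * 9, by positivity, fun n hn => ?_⟩
  have hn1 : (1:ℝ) ≤ n := by exact_mod_cast hn
  have hl3 := NT_log3 n hn1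
  have hll : 0 ≤ Real.log (Real.log (3 * n)) := Real.log_nonneg hl3
  set Λ := Real.log (3 * n) with hΛ
  set y : ℕ := ⌈Λ⌉₊ + 1 with hy
  have hy1 : Λ ≤ y := by
    rw [hy]; push_cast; linarith [Nat.le_ceil Λ]
  have hy2 : (y:ℝ) ≤ 3 * Λ := by
    rw [hy]; push_cast; linarith [Nat.ceil_lt_add_one (a := Λ) (by linarith)]
  have hy3 : 2 ≤ y := by
    have : 0 < ⌈Λ⌉₊ := Nat.ceil_pos.2 (by linarith)
    omega
  have hy3' : (2:ℝ) ≤ y := by exact_mod_cast hy3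
  have hylog : 0 < Real.log y := Real.log_pos (by linarith)
  -- totient product
  have htot : (n.totient : ℝ) = n * ∏ p ∈ n.primeFactors, (1 - (p:ℝ)⁻¹) := by
    have := Nat.totient_eq_mul_prod_factors n
    have h2 := congrArg (fun q : ℚ => (q:ℝ)) this
    push_cast at h2
    exact h2
  have hfac : ∀ p ∈ n.primeFactors, Real.exp (-(1 / p + 1 / ((p:ℝ) * (p - 1)))) ≤ 1 - (p:ℝ)⁻¹ := by
    intro p hp
    have hp2 : (2:ℝ) ≤ p := by exact_mod_cast (Nat.prime_of_mem_primeFactors hp).two_le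
    have hp1 : 0 < (p:ℝ) - 1 := by linarith
    have e : 1 / (p:ℝ) + 1 / ((p:ℝ) * (p - 1)) = 1 / (p - 1) := by field_simp; ring
    rw [e, Real.exp_neg]
    have : 1 - (p:ℝ)⁻¹ = (1 + 1 / ((p:ℝ) - 1))⁻¹ := by field_simp; ring
    rw [this]
    apply inv_anti₀ (by positivity)
    linarith [Real.add_one_le_exp (1 / ((p:ℝ) - 1))]
  have hprod : Real.exp (-(∑ p ∈ n.primeFactors, (1 / (p:ℝ)) + 1)) ≤ ∏ p ∈ n.primeFactors, (1 - (p:ℝ)⁻¹) := by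
    refine le_trans ?_ (Finset.prod_le_prod (fun _ _ => (Real.exp_pos _).le) hfac)
    rw [← Real.exp_sum, Real.exp_le_exp, Finset.sum_neg_distrib, neg_le_neg_iff, Finset.sum_add_distrib]
    have := NT_sumTele n.primeFactors (fun p hp => (Nat.prime_of_mem_primeFactors hp).two_le)
    linarith
  have hcard : (n.primeFactors.card : ℝ) * Real.log 2 ≤ Λ := by
    have h1 : 2 ^ n.primeFactors.card ≤ n := by
      calc 2 ^ n.primeFactors.card = ∏ p ∈ n.primeFactors, 2 := by simp
        _ ≤ ∏ p ∈ n.primeFactors, p := Finset.prod_le_prod' (fun p hp => (Nat.prime_of_mem_primeFactors hp).two_le)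
        _ ≤ n := Nat.le_of_dvd hn (Nat.prod_primeFactors_dvd n)
    have h2 : ((2:ℝ) ^ n.primeFactors.card) ≤ 3 * n := by
      have : ((2:ℝ) ^ n.primeFactors.card) ≤ n := by exact_mod_cast h1
      linarith
    have := Real.log_le_log (by positivity) h2
    rwa [Real.log_pow] at this
  have hsum : ∑ p ∈ n.primeFactors, (1 / (p:ℝ)) ≤ Real.log 4 * (Real.log (Real.log y) + 2) + 2 := by
    rw [← Finset.sum_filter_add_sum_filter_not n.primeFactors (fun p => p ≤ y)]
    apply add_le_add
    · refine le_trans ?_ (NT_primeSum' y hy3)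
      apply Finset.sum_le_sum_of_subset_of_nonneg
      · intro p hp
        rw [Finset.mem_filter] at hp
        rw [Finset.mem_filter, Finset.mem_Icc]
        have := Nat.prime_of_mem_primeFactors hp.1
        exact ⟨⟨this.one_lt.le, hp.2⟩, this⟩
      · intros; positivity
    · calc ∑ p ∈ n.primeFactors.filter (fun p => ¬ p ≤ y), (1 / (p:ℝ))
          ≤ ∑ p ∈ n.primeFactors.filter (fun p => ¬ p ≤ y), (1 / (y:ℝ)) := by
            apply Finset.sum_le_sum
            intro p hp
            rw [Finset.mem_filter, not_le] at hp
            apply one_div_le_one_div_of_le (by linarith)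
            exact_mod_cast hp.2.le
        _ = ((n.primeFactors.filter (fun p => ¬ p ≤ y)).card : ℝ) * (1 / y) := by
            rw [Finset.sum_const, nsmul_eq_mul]
        _ ≤ (n.primeFactors.card : ℝ) * (1 / y) := by
            gcongr; exact Finset.filter_subset _ _
        _ ≤ 2 := by
            rw [mul_one_div, div_le_iff₀ (by linarith)]
            have := Real.log_two_gt_d9
            nlinarith
  have hB : Real.log 4 * Real.log (Real.log y) ≤ 2 * Real.log (3 * (1 + Real.log Λ)) := by
    have h4 : Real.log 4 ≤ 2 := by
      rw [show (4:ℝ) = 2 ^ 2 by norm_num, Real.log_pow]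
      have := Real.log_two_lt_d9
      push_cast; linarith
    have h40 : 0 ≤ Real.log 4 := Real.log_nonneg (by norm_num)
    have h0 : 0 ≤ Real.log (3 * (1 + Real.log Λ)) := Real.log_nonneg (by linarith)
    have h5 : Real.log (Real.log y) ≤ Real.log (3 * (1 + Real.log Λ)) := by
      apply Real.log_le_log hylog
      have : Real.log y ≤ Real.log (3 * Λ) := Real.log_le_log (by linarith) hy2
      rw [Real.log_mul (by norm_num) (by linarith)] at this
      have h3 : Real.log 3 ≤ 2 := by
        have := Real.log_le_sub_one_of_pos (x := 3) (by norm_num)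
        linarith
      linarith
    nlinarith
  have hE : Real.exp (-(2 * Real.log 4 + 3)) * (9 * (1 + Real.log Λ)^2)⁻¹ ≤ ∏ p ∈ n.primeFactors, (1 - (p:ℝ)⁻¹) := by
    refine le_trans ?_ hprod
    have e2 : (9 * (1 + Real.log Λ)^2)⁻¹ = Real.exp (-(2 * Real.log (3 * (1 + Real.log Λ)))) := by
      rw [Real.exp_neg, show (2:ℝ) * Real.log (3 * (1 + Real.log Λ)) = Real.log ((3 * (1 + Real.log Λ))^2) by
        rw [Real.log_pow]; norm_num, Real.exp_log (by positivity)]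
      ring
    rw [e2, ← Real.exp_add, Real.exp_le_exp]
    linarith
  rw [htot]
  have hP : (0:ℝ) < 9 * (1 + Real.log Λ)^2 := by positivity
  rw [Real.exp_neg, ← mul_inv, inv_le_iff_one_le_mul₀ (by positivity)] at hE
  nlinarith

lemma NT_totient2 : ∃ K : ℝ, 0 < K ∧ ∀ n δ : ℕ, ∀ s : ℝ, 0 < n → 0 < δ → 1 ≤ s → (δ:ℝ) ≤ n * s →
    1 / (n.totient : ℝ) ≤ K * (1 + Real.log (Real.log (3 * δ))) ^ 2 * (s / δ) := by
  obtain ⟨K, hK, h⟩ := NT_totient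
  refine ⟨4 * K, by positivity, fun n δ s hn hδ hs hle => ?_⟩
  have hn1 : (1:ℝ) ≤ n := by exact_mod_cast hn
  have hδ1 : (1:ℝ) ≤ δ := by exact_mod_cast hδ
  have hφ : (0:ℝ) < n.totient := by exact_mod_cast Nat.totient_pos.2 hn
  have hlδ := NT_log3 δ hδ1
  have hln := NT_log3 n hn1
  have hLδ : 0 ≤ Real.log (Real.log (3 * δ)) := Real.log_nonneg hlδ
  have hLn : 0 ≤ Real.log (Real.log (3 * n)) := Real.log_nonneg hln
  have h1 : 1 / (n.totient : ℝ) ≤ K * (1 + Real.log (Real.log (3 * n))) ^ 2 / n := by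
    rw [div_le_div_iff₀ hφ (by linarith)]
    have := h n hn
    linarith
  refine h1.trans ?_
  by_cases hc : n ≤ δ
  · have hc' : (n:ℝ) ≤ δ := by exact_mod_cast hc
    have h2 : Real.log (Real.log (3 * n)) ≤ Real.log (Real.log (3 * δ)) :=
      Real.log_le_log (by linarith) (Real.log_le_log (by linarith) (by linarith))
    have h3 : 1 / (n:ℝ) ≤ s / δ := by
      rw [div_le_div_iff₀ (by linarith) (by linarith)]; linarith
    rw [div_eq_mul_one_div]
    apply mul_le_mul _ h3 (by positivity) (by positivity)
    have : K * (1 + Real.log (Real.log (3 * n))) ^ 2 ≤ K * (1 + Real.log (Real.log (3 * δ))) ^ 2 := by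
      gcongr
    have h5 : 0 ≤ K * (1 + Real.log (Real.log (3 * δ))) ^ 2 := by positivity
    linarith
  · have hc' : (δ:ℝ) ≤ n := by exact_mod_cast (not_le.1 hc).le
    set r := (n:ℝ) / δ with hr
    have hr1 : 1 ≤ r := by rw [hr, le_div_iff₀ (by linarith)]; linarith
    have hlr : 0 ≤ Real.log r := Real.log_nonneg hr1
    have hnr : (3 * n : ℝ) = (3 * δ) * r := by rw [hr]; field_simp
    have h2 : Real.log (3 * n) ≤ Real.log (3 * δ) * (1 + Real.log r) := by
      rw [hnr, Real.log_mul (by positivity) (by positivity)]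
      nlinarith
    have h3 : Real.log (Real.log (3 * n)) ≤ Real.log (Real.log (3 * δ)) + Real.log r := by
      refine (Real.log_le_log (by linarith) h2).trans ?_
      rw [Real.log_mul (by linarith) (by linarith)]
      have := Real.log_le_sub_one_of_pos (x := 1 + Real.log r) (by linarith)
      linarith
    have h4 : 1 + Real.log (Real.log (3 * n)) ≤ (1 + Real.log (Real.log (3 * δ))) * (1 + Real.log r) := by
      nlinarith
    have h5 : 1 + Real.log r ≤ 2 * Real.sqrt r := by
      have hs : 0 < Real.sqrt r := Real.sqrt_pos.2 (by linarith)
      have := Real.log_le_sub_one_of_pos hs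
      rw [Real.log_sqrt (by linarith)] at this
      linarith
    have h6 : (1 + Real.log (Real.log (3 * n)))^2 ≤ (1 + Real.log (Real.log (3 * δ)))^2 * (4 * r) := by
      calc _ ≤ ((1 + Real.log (Real.log (3 * δ))) * (2 * Real.sqrt r))^2 := by
            apply pow_le_pow_left₀ (by linarith)
            exact h4.trans (by gcongr)
        _ = _ := by rw [mul_pow, mul_pow, Real.sq_sqrt (by linarith)]; ring
    rw [div_le_iff₀ (by linarith)]
    have e : 4 * K * (1 + Real.log (Real.log (3 * δ))) ^ 2 * (s / δ) * n
       = K * ((1 + Real.log (Real.log (3 * δ)))^2 * (4 * r)) * s := by rw [hr]; ring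
    rw [e]
    calc _ ≤ K * ((1 + Real.log (Real.log (3 * δ)))^2 * (4 * r)) := by gcongr
      _ ≤ _ := le_mul_of_one_le_right (by positivity) hs

lemma RS_primitive (n : ℕ) (hn : 0 < n) :
    ∑ ζ ∈ primitiveRoots n ℂ, ζ = (ArithmeticFunction.moebius n : ℂ) := by
  have h1 : ∀ n > 0, ∑ i ∈ n.divisors, (∑ ζ ∈ primitiveRoots i ℂ, ζ) =
      (if n = 1 then (1:ℂ) else 0) := by
    intro n hn
    have hne : NeZero n := ⟨hn.ne'⟩
    rw [← Finset.sum_biUnion (fun i _ j _ hij => IsPrimitiveRoot.disjoint hij),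
      ← IsPrimitiveRoot.nthRoots_one_eq_biUnion_primitiveRoots]
    have hp := Complex.isPrimitiveRoot_exp n hn.ne'
    set z := Complex.exp (2 * ↑Real.pi * Complex.I / ↑n)
    have him : Polynomial.nthRootsFinset n (1:ℂ) = (Finset.range n).image (fun i => z ^ i) := by
      ext w
      rw [Polynomial.mem_nthRootsFinset hn, Finset.mem_image]
      constructor
      · intro h
        obtain ⟨i, hi, rfl⟩ := hp.eq_pow_of_pow_eq_one h
        exact ⟨i, Finset.mem_range.2 hi, rfl⟩
      · rintro ⟨i, hi, rfl⟩
        rw [← pow_mul, mul_comm, pow_mul, hp.pow_eq_one, one_pow]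
    rw [him, Finset.sum_image (fun i hi j hj hij => hp.pow_inj (Finset.mem_range.1 hi) (Finset.mem_range.1 hj) hij)]
    split_ifs with h
    · simp [h]
    · exact hp.geom_sum_eq_zero (by omega)
  have h2 := (ArithmeticFunction.sum_eq_iff_sum_mul_moebius_eq (R := ℂ)).1 h1 n hn
  rw [← h2, Finset.sum_eq_single (n, 1)]
  · simp
  · rintro ⟨a, b⟩ hab hne
    rw [Nat.mem_divisorsAntidiagonal] at hab
    simp only at hab ⊢
    rw [if_neg, mul_zero]
    rintro rfl
    apply hne
    rw [← hab.1, mul_one]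
  · intro h
    exfalso; apply h
    rw [Nat.mem_divisorsAntidiagonal]
    exact ⟨mul_one n, hn.ne'⟩

lemma RS_units (m : ℕ) [NeZero m] (f : ℕ → ℂ) :
    ∑ k ∈ (Finset.range m).filter (fun k => Nat.Coprime k m), f k =
      ∑ u : (ZMod m)ˣ, f (u : ZMod m).val := by
  symm
  apply Finset.sum_bij (fun (u : (ZMod m)ˣ) _ => (u : ZMod m).val)
  · intro u _
    rw [Finset.mem_filter, Finset.mem_range]
    exact ⟨ZMod.val_lt _, ZMod.val_coe_unit_coprime u⟩
  · intro u _ v _ h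
    exact Units.ext (ZMod.val_injective m h)
  · intro k hk
    rw [Finset.mem_filter, Finset.mem_range] at hk
    refine ⟨ZMod.unitOfCoprime k hk.2, Finset.mem_univ _, ?_⟩
    rw [ZMod.coe_unitOfCoprime, ZMod.val_natCast, Nat.mod_eq_of_lt hk.1]
  · intros; rfl

lemma RS_bound (m : ℕ) (hm : 0 < m) (z : ℂ) (hz : z ^ m = 1) :
    ‖∑ k ∈ (Finset.range m).filter (fun k => Nat.Coprime k m), z ^ k‖ ≤
      (m.totient : ℝ) * (1 / ((orderOf z).totient : ℝ)) := by
  have hne : NeZero m := ⟨hm.ne'⟩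
  set n := orderOf z with hn
  have hdvd : n ∣ m := orderOf_dvd_of_pow_eq_one hz
  have hn0 : 0 < n := Nat.pos_of_dvd_of_pos hdvd hm
  have hnen : NeZero n := ⟨hn0.ne'⟩
  have hprim : IsPrimitiveRoot z n := IsPrimitiveRoot.orderOf z
  set F : (ZMod m)ˣ →* (ZMod n)ˣ := ZMod.unitsMap hdvd with hF
  have hsurj : Function.Surjective F := ZMod.unitsMap_surjective hdvd
  have h1 : ∀ u : (ZMod m)ˣ, z ^ (u : ZMod m).val = z ^ ((F u : ZMod n)).val := by
    intro u
    rw [hF, ZMod.unitsMap_val, ZMod.cast_eq_val, ZMod.val_natCast, ← pow_mod_orderOf]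
  set q := (Finset.univ.filter (fun u => F u = 1)).card with hq
  have hfib : ∀ v : (ZMod n)ˣ, (Finset.univ.filter (fun u => F u = v)).card = q := by
    intro v
    exact MonoidHom.card_fiber_eq_of_mem_range F (hsurj v) (hsurj 1)
  have hcard : m.totient = n.totient * q := by
    have := Finset.card_eq_sum_card_fiberwise (f := F) (s := Finset.univ) (t := Finset.univ)
      (fun _ _ => Finset.mem_coe.2 (Finset.mem_univ _))
    simp only [hfib] at this
    rw [Finset.card_univ, ZMod.card_units_eq_totient, Finset.sum_const, Finset.card_univ,
      ZMod.card_units_eq_totient, smul_eq_mul] at this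
    exact this
  have hsum : ∑ k ∈ (Finset.range m).filter (fun k => Nat.Coprime k m), z ^ k
      = q * (ArithmeticFunction.moebius n : ℂ) := by
    rw [RS_units m (fun k => z ^ k)]
    simp only [h1]
    rw [← Finset.sum_fiberwise Finset.univ F]
    have : ∀ v : (ZMod n)ˣ, ∑ u ∈ Finset.univ.filter (fun u => F u = v), z ^ ((F u : ZMod n)).val
        = q * z ^ ((v : ZMod n)).val := by
      intro v
      rw [Finset.sum_congr rfl (g := fun _ => z ^ ((v : ZMod n)).val)]
      · rw [Finset.sum_const, hfib, nsmul_eq_mul]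
      · intro u hu
        rw [(Finset.mem_filter.1 hu).2]
    simp only [this]
    rw [← Finset.mul_sum, ← RS_units n (fun k => z ^ k), ← RS_primitive n hn0]
    congr 1
    have him : primitiveRoots n ℂ = ((Finset.range n).filter (fun k => Nat.Coprime k n)).image (fun i => z ^ i) := by
      ext w
      rw [mem_primitiveRoots hn0, hprim.isPrimitiveRoot_iff, Finset.mem_image]
      simp only [Finset.mem_filter, Finset.mem_range, and_assoc]
    rw [him, Finset.sum_image]
    intro i hi j hj hij
    have hi' := (Finset.mem_filter.1 hi).1
    have hj' := (Finset.mem_filter.1 hj).1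
    exact hprim.pow_inj (Finset.mem_range.1 hi') (Finset.mem_range.1 hj') hij
  rw [hsum, norm_mul, hcard]
  have hφ : (0:ℝ) < n.totient := by exact_mod_cast Nat.totient_pos.2 hn0
  have hmu : ‖(ArithmeticFunction.moebius n : ℂ)‖ ≤ 1 := by
    rw [Complex.norm_intCast]
    exact_mod_cast ArithmeticFunction.abs_moebius_le_one
  have : ((n.totient * q : ℕ) : ℝ) * (1 / (n.totient : ℝ)) = q := by
    push_cast; field_simp
  rw [this, Complex.norm_natCast]
  exact mul_le_of_le_one_right (by positivity) hmu

noncomputable def habs {m : ℕ} (h : ZMod m) : ℕ := h.valMinAbs.natAbs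

lemma habs_neg {m : ℕ} (h : ZMod m) : habs (-h) = habs h := by
  unfold habs
  exact ZMod.natAbs_valMinAbs_neg h

lemma habs_pos {m : ℕ} [NeZero m] (h : ZMod m) (hh : h ≠ 0) : 1 ≤ habs h := by
  unfold habs
  have : h.valMinAbs ≠ 0 := by rwa [Ne, ZMod.valMinAbs_eq_zero]
  omega

lemma char_norm (m : ℕ) [NeZero m] (x : ZMod m) : ‖ZMod.stdAddChar x‖ = 1 := by
  rw [ZMod.stdAddChar_apply]; exact Circle.norm_coe _

lemma char_sub_one (m : ℕ) [NeZero m] (h : ZMod m) :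
    4 * (habs h : ℝ) / m ≤ ‖ZMod.stdAddChar h - 1‖ := by
  have hm : (0:ℝ) < m := by exact_mod_cast NeZero.pos m
  have e : ZMod.stdAddChar h = Complex.exp (Complex.I * ((2 * Real.pi * h.valMinAbs / m : ℝ) : ℂ)) := by
    conv_lhs => rw [← ZMod.coe_valMinAbs h]
    rw [ZMod.stdAddChar_coe]
    congr 1
    push_cast
    ring
  rw [e, Complex.norm_exp_I_mul_ofReal_sub_one, norm_mul, Real.norm_eq_abs, Real.norm_eq_abs]
  have hle : (habs h : ℝ) ≤ m / 2 := by
    have := ZMod.natAbs_valMinAbs_le h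
    have h2 : 2 * habs h ≤ m := by unfold habs; omega
    have h3 : (2:ℝ) * habs h ≤ m := by exact_mod_cast h2
    linarith
  have hab : (habs h : ℝ) = |(h.valMinAbs : ℝ)| := by
    unfold habs
    rw [Nat.cast_natAbs]; push_cast; rfl
  have hx : |2 * Real.pi * h.valMinAbs / m / 2| = Real.pi * habs h / m := by
    rw [hab, show 2 * Real.pi * (h.valMinAbs:ℝ) / m / 2 = (Real.pi / m) * h.valMinAbs by ring, abs_mul,
      abs_of_pos (by positivity)]
    ring
  have := Real.mul_abs_le_abs_sin (x := 2 * Real.pi * h.valMinAbs / m / 2) (by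
    rw [hx, div_le_div_iff₀ hm (by norm_num)]
    nlinarith [Real.pi_pos])
  rw [hx] at this
  have e2 : 2 / Real.pi * (Real.pi * habs h / m) = 2 * habs h / m := by
    field_simp
  rw [e2] at this
  rw [abs_of_pos (by norm_num : (0:ℝ) < 2)]
  have e3 : 4 * (habs h : ℝ) / m = 2 * (2 * habs h / m) := by ring
  rw [e3]
  linarith

lemma char_geom (m : ℕ) [NeZero m] (h : ZMod m) (hh : h ≠ 0) (M : ℕ) :
    ‖∑ u ∈ Finset.range M, (ZMod.stdAddChar h) ^ u‖ ≤ m / (2 * habs h) := by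
  have hm : (0:ℝ) < m := by exact_mod_cast NeZero.pos m
  have hp : (1:ℝ) ≤ habs h := by exact_mod_cast habs_pos h hh
  have h1 := char_sub_one m h
  have hpos : 0 < ‖ZMod.stdAddChar h - 1‖ := lt_of_lt_of_le (by positivity) h1
  have hne : ZMod.stdAddChar h ≠ 1 := by
    intro h; rw [h] at hpos; simp at hpos
  rw [geom_sum_eq hne, norm_div, div_le_iff₀ hpos]
  have h2 : ‖ZMod.stdAddChar h ^ M - 1‖ ≤ 2 := by
    refine (norm_sub_le _ _).trans ?_
    rw [norm_pow, char_norm]; norm_num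
  refine h2.trans ?_
  calc (2:ℝ) = m / (2 * habs h) * (4 * habs h / m) := by field_simp; norm_num
    _ ≤ _ := by gcongr

lemma char_geom' (m : ℕ) [NeZero m] (h : ZMod m) (M : ℕ) :
    ‖∑ u ∈ Finset.range M, (ZMod.stdAddChar h) ^ u‖ ≤ M := by
  refine (norm_sum_le _ _).trans ?_
  simp [norm_pow]

lemma coord (m : ℕ) [NeZero m] (L : ℕ) (hL : 0 < L) (a b : ℝ) (hab : a ≤ b) :
    ∃ (c : ZMod m → ℂ) (g : ZMod m → ℝ) (γ : ℝ), (∀ y, 0 ≤ g y) ∧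
      (∀ y, a ≤ (y.val : ℝ) / m → (y.val : ℝ) / m < b → 1 ≤ g y) ∧
      (∀ y, (g y : ℂ) = ∑ h, c h * ZMod.stdAddChar (h * y)) ∧
      c 0 = (γ : ℂ) ∧ 0 ≤ γ ∧ γ ≤ b - a + 3 * L / m ∧
      ∀ h ≠ 0, ‖c h‖ ≤ 1 / (2 * habs h) ∧ ‖c h‖ ≤ (m:ℝ)^2 / (8 * L^2 * (habs h)^3) := by
  have hm : (0:ℝ) < m := by exact_mod_cast NeZero.pos m
  have hLr : (1:ℝ) ≤ L := by exact_mod_cast hL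
  set s0 : ℤ := ⌈a * m⌉ - L with hs0
  have hcl : ⌈a * m⌉ ≤ ⌈b * m⌉ := Int.ceil_le_ceil (by gcongr)
  set M : ℕ := (⌈b * m⌉ - ⌈a * m⌉).toNat + 2 * L with hM
  have hMz : (M : ℤ) = ⌈b * m⌉ - ⌈a * m⌉ + 2 * L := by rw [hM]; push_cast; omega
  let ψ : AddChar (ZMod m) ℂ := ZMod.stdAddChar
  have hψ : ψ.IsPrimitive := ZMod.isPrimitive_stdAddChar m
  let c : ZMod m → ℂ := fun h => (1 / ((m:ℂ) * (L:ℂ)^2)) * (ψ (-h * (s0 : ZMod m)) *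
    ((∑ u ∈ Finset.range M, (ψ (-h)) ^ u) * ((∑ s ∈ Finset.range L, (ψ (-h)) ^ s) *
      (∑ t ∈ Finset.range L, (ψ h) ^ t))))
  let g : ZMod m → ℝ := fun y => (1 / (L:ℝ)^2) * ∑ s ∈ Finset.range L, ∑ t ∈ Finset.range L,
    ∑ u ∈ Finset.range M, (if y - s0 - u - s + t = 0 then (1:ℝ) else 0)
  have hmc : (m:ℂ) ≠ 0 := by exact_mod_cast hm.ne'
  have hLc : (L:ℂ) ≠ 0 := by exact_mod_cast hL.ne'
  refine ⟨c, g, M / m, ?_, ?_, ?_, ?_, by positivity, ?_, ?_⟩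
  · intro y
    apply mul_nonneg (by positivity)
    apply Finset.sum_nonneg; intro s _
    apply Finset.sum_nonneg; intro t _
    apply Finset.sum_nonneg; intro u _
    split_ifs <;> norm_num
  · intro y h1 h2
    rw [le_div_iff₀ hm] at h1
    rw [div_lt_iff₀ hm] at h2
    have h1' : ⌈a * m⌉ ≤ (y.val : ℤ) := Int.ceil_le.2 (by exact_mod_cast h1)
    have h2' : (y.val : ℤ) < ⌈b * m⌉ := Int.lt_ceil.2 (by exact_mod_cast h2)
    have key : ∀ s ∈ Finset.range L, ∀ t ∈ Finset.range L, (1:ℝ) ≤ 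
        ∑ u ∈ Finset.range M, (if y - s0 - u - s + t = 0 then (1:ℝ) else 0) := by
      intro s hs t ht
      rw [Finset.mem_range] at hs ht
      obtain ⟨u, hu⟩ := Int.eq_ofNat_of_zero_le (a := (y.val : ℤ) - s0 - s + t) (by omega)
      have huM : u ∈ Finset.range M := by rw [Finset.mem_range]; omega
      refine le_trans (le_of_eq ?_) (Finset.single_le_sum (f := fun u : ℕ => (if y - s0 - u - s + t = 0 then (1:ℝ) else 0))
        (fun i _ => by split_ifs <;> norm_num) huM)
      rw [if_pos]
      have hz : y = ((y.val : ℤ) : ZMod m) := by simp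
      have : y - s0 - u - s + t = (((y.val : ℤ) - s0 - u - s + t : ℤ) : ZMod m) := by
        push_cast; rw [ZMod.natCast_zmod_val]
      rw [this, show ((y.val : ℤ) - s0 - u - s + t : ℤ) = 0 by omega, Int.cast_zero]
    have : (L:ℝ)^2 ≤ ∑ s ∈ Finset.range L, ∑ t ∈ Finset.range L,
      ∑ u ∈ Finset.range M, (if y - s0 - u - s + t = 0 then (1:ℝ) else 0) := by
      calc (L:ℝ)^2 = ∑ s ∈ Finset.range L, ∑ t ∈ Finset.range L, (1:ℝ) := by simp; ring
        _ ≤ _ := Finset.sum_le_sum (fun s hs => Finset.sum_le_sum (fun t ht => key s hs t ht))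
    show 1 ≤ (1 / (L:ℝ)^2) * _
    rw [one_div, ← div_eq_inv_mul, le_div_iff₀ (by positivity), one_mul]
    exact this
  · intro y
    have hc : ∀ h, c h * ψ (h * y) = (1 / ((m:ℂ) * (L:ℂ)^2)) * ∑ s ∈ Finset.range L, ∑ t ∈ Finset.range L,
        ∑ u ∈ Finset.range M, ψ (h * (y - s0 - u - s + t)) := by
      intro h
      have e : ∀ s t u : ℕ, ψ (h * (y - s0 - u - s + t)) =
        ψ (-h * s0) * ψ (h * y) * (ψ (-h)) ^ s * (ψ h) ^ t * (ψ (-h)) ^ u := by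
        intro s t u
        rw [← AddChar.map_nsmul_eq_pow, ← AddChar.map_nsmul_eq_pow, ← AddChar.map_nsmul_eq_pow,
          ← AddChar.map_add_eq_mul, ← AddChar.map_add_eq_mul, ← AddChar.map_add_eq_mul, ← AddChar.map_add_eq_mul]
        congr 1
        simp only [nsmul_eq_mul]
        ring
      simp only [e, ← Finset.mul_sum, ← Finset.sum_mul]
      show (1 / ((m:ℂ) * (L:ℂ)^2)) * (ψ (-h * (s0 : ZMod m)) *
    ((∑ u ∈ Finset.range M, (ψ (-h)) ^ u) * ((∑ s ∈ Finset.range L, (ψ (-h)) ^ s) *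
      (∑ t ∈ Finset.range L, (ψ h) ^ t)))) * _ = _
      ring
    have : ∑ h, c h * ZMod.stdAddChar (h * y) = ∑ h, c h * ψ (h * y) := rfl
    rw [this]
    simp only [hc]
    rw [← Finset.mul_sum, Finset.sum_comm]
    have e2 : ∀ s ∈ Finset.range L, ∑ h : ZMod m, ∑ t ∈ Finset.range L,
        ∑ u ∈ Finset.range M, ψ (h * (y - s0 - u - s + t)) =
        (m:ℂ) * ∑ t ∈ Finset.range L, ∑ u ∈ Finset.range M, (if y - s0 - u - s + t = 0 then (1:ℂ) else 0) := by
      intro s _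
      rw [Finset.sum_comm, Finset.mul_sum]
      apply Finset.sum_congr rfl; intro t _
      rw [Finset.sum_comm, Finset.mul_sum]
      apply Finset.sum_congr rfl; intro u _
      rw [AddChar.sum_mulShift _ hψ, ZMod.card]
      split_ifs <;> simp
    rw [Finset.sum_congr rfl e2, ← Finset.mul_sum]
    show (((1 / (L:ℝ)^2) * ∑ s ∈ Finset.range L, ∑ t ∈ Finset.range L,
      ∑ u ∈ Finset.range M, (if y - s0 - u - s + t = 0 then (1:ℝ) else 0) : ℝ) : ℂ) = _
    push_cast
    field_simp
    apply Finset.sum_congr rfl; intro s _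
    apply Finset.sum_congr rfl; intro t _
    apply Finset.sum_congr rfl; intro u _
    split_ifs <;> simp
  · show (1 / ((m:ℂ) * (L:ℂ)^2)) * (ψ (-0 * (s0 : ZMod m)) *
    ((∑ u ∈ Finset.range M, (ψ (-0)) ^ u) * ((∑ s ∈ Finset.range L, (ψ (-0)) ^ s) *
      (∑ t ∈ Finset.range L, (ψ 0) ^ t)))) = _
    simp only [neg_zero, zero_mul, AddChar.map_zero_eq_one, one_pow, Finset.sum_const, Finset.card_range,
      nsmul_eq_mul, mul_one, one_mul]
    push_cast
    field_simp
  · have : (M:ℝ) = ⌈b * m⌉ - ⌈a * m⌉ + 2 * L := by exact_mod_cast hMz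
    rw [div_le_iff₀ hm, this]
    have h1 := Int.ceil_lt_add_one (b * m)
    have h2 := Int.le_ceil (a * m)
    have e : (b - a + 3 * L / m) * m = b * m - a * m + 3 * L := by field_simp
    rw [e]
    linarith
  · intro h hh
    have hp : (1:ℝ) ≤ habs h := by exact_mod_cast habs_pos h hh
    have hnorm : ‖c h‖ = (1 / ((m:ℝ) * (L:ℝ)^2)) * 
      (‖∑ u ∈ Finset.range M, (ψ (-h)) ^ u‖ * (‖∑ s ∈ Finset.range L, (ψ (-h)) ^ s‖ *
      ‖∑ t ∈ Finset.range L, (ψ h) ^ t‖)) := by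
      show ‖(1 / ((m:ℂ) * (L:ℂ)^2)) * (ψ (-h * (s0 : ZMod m)) *
    ((∑ u ∈ Finset.range M, (ψ (-h)) ^ u) * ((∑ s ∈ Finset.range L, (ψ (-h)) ^ s) *
      (∑ t ∈ Finset.range L, (ψ h) ^ t))))‖ = _
      rw [norm_mul, norm_mul, norm_mul, norm_mul, show ‖ψ (-h * (s0 : ZMod m))‖ = 1 from char_norm m _]
      simp
    have hA := char_geom m (-h) (neg_ne_zero.2 hh) M
    have hB := char_geom m (-h) (neg_ne_zero.2 hh) L
    have hC := char_geom m h hh L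
    have hB' := char_geom' m (-h) L
    have hC' := char_geom' m h L
    rw [habs_neg] at hA hB
    rw [hnorm]
    constructor
    · calc _ ≤ (1 / ((m:ℝ) * (L:ℝ)^2)) * (m / (2 * habs h) * (L * L)) := by gcongr
        _ = _ := by field_simp
    · calc _ ≤ (1 / ((m:ℝ) * (L:ℝ)^2)) * (m / (2 * habs h) * (m / (2 * habs h) * (m / (2 * habs h)))) := by gcongr
        _ = _ := by field_simp; norm_num

noncomputable def wmaj (ε : ℝ) (j : ℕ) : ℝ :=
  if j = 0 then 4 else min (1 / (2 * (j:ℝ))) (1 / (8 * ε^2 * (j:ℝ)^3))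

lemma wmaj_nonneg (ε : ℝ) (j : ℕ) : 0 ≤ wmaj ε j := by
  unfold wmaj
  split_ifs
  · norm_num
  · positivity

lemma sum_habs (m : ℕ) [NeZero m] (f : ℕ → ℝ) (hf : ∀ j, 0 ≤ f j) :
    ∑ h : ZMod m, f (habs h) ≤ f 0 + 2 * ∑ j ∈ Finset.Icc 1 m, f j := by
  have h1 : ∑ h : ZMod m, f (habs h) = ∑ z ∈ Finset.univ.image (fun h : ZMod m => h.valMinAbs), f z.natAbs := by
    rw [Finset.sum_image]
    · rfl
    · intro x _ y _ h
      exact ZMod.injective_valMinAbs h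
  rw [h1]
  have hsub : Finset.univ.image (fun h : ZMod m => h.valMinAbs) ⊆
     {0} ∪ ((Finset.Icc 1 m).image (fun j : ℕ => (j:ℤ)) ∪ (Finset.Icc 1 m).image (fun j : ℕ => -(j:ℤ))) := by
    intro z hz
    obtain ⟨h, _, rfl⟩ := Finset.mem_image.1 hz
    have := ZMod.natAbs_valMinAbs_le h
    simp only [Finset.mem_union, Finset.mem_singleton, Finset.mem_image, Finset.mem_Icc]
    rcases lt_trichotomy h.valMinAbs 0 with hl | hl | hl
    · right; right
      exact ⟨h.valMinAbs.natAbs, by omega, by omega⟩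
    · left; exact hl
    · right; left
      exact ⟨h.valMinAbs.natAbs, by omega, by omega⟩
  have hU : ∀ A B : Finset ℤ, ∑ z ∈ A ∪ B, f z.natAbs ≤ ∑ z ∈ A, f z.natAbs + ∑ z ∈ B, f z.natAbs := by
    intro A B
    rw [← Finset.sum_union_inter]
    linarith [Finset.sum_nonneg (s := A ∩ B) (f := fun z => f z.natAbs) (fun z _ => hf _)]
  refine (Finset.sum_le_sum_of_subset_of_nonneg hsub (fun _ _ _ => hf _)).trans ?_
  refine (hU _ _).trans ?_
  have h2 := hU ((Finset.Icc 1 m).image (fun j : ℕ => (j:ℤ))) ((Finset.Icc 1 m).image (fun j : ℕ => -(j:ℤ)))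
  rw [Finset.sum_image (by intro x _ y _ h; simpa using h), Finset.sum_image (by intro x _ y _ h; simpa using h)] at h2
  simp only [Int.natAbs_natCast, Int.natAbs_neg] at h2
  simp only [Finset.sum_singleton, Int.natAbs_zero]
  linarith

lemma wsum_aux (m K : ℕ) (hK : 0 < K) :
   ∑ j ∈ (Finset.Icc 1 m).filter (fun j => ¬ j ≤ K), ((j:ℝ)^2)⁻¹ ≤ 1 / K := by
  have hsub : (Finset.Icc 1 m).filter (fun j => ¬ j ≤ K) ⊆ Finset.Ioc K (K + m) := by
    intro j hj
    simp only [Finset.mem_filter, Finset.mem_Icc] at hj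
    rw [Finset.mem_Ioc]; omega
  refine (Finset.sum_le_sum_of_subset_of_nonneg hsub (fun _ _ _ => by positivity)).trans ?_
  have := sum_Ioc_inv_sq_le_sub (α := ℝ) (k := K) (n := K + m) hK.ne' (by omega)
  have h2 : (0:ℝ) ≤ ((K + m : ℕ) : ℝ)⁻¹ := by positivity
  rw [one_div]; linarith

lemma wsum1 (m : ℕ) (ε : ℝ) (hε : 0 < ε) (hε1 : ε ≤ 1) :
    ∑ j ∈ Finset.Icc 1 m, wmaj ε j ≤ 1 + Real.log (2 / ε) := by
  set K := ⌈1 / ε⌉₊ with hKd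
  have hK : 0 < K := Nat.ceil_pos.2 (by positivity)
  have hK1 : 1 / ε ≤ K := Nat.le_ceil _
  have hK2 : (K:ℝ) ≤ 2 / ε := by
    have := Nat.ceil_lt_add_one (a := 1 / ε) (by positivity)
    have h1 : 1 ≤ 1 / ε := by rw [le_div_iff₀ hε]; linarith
    have : (2:ℝ) / ε = 1 / ε + 1 / ε := by ring
    linarith
  have hKr : (0:ℝ) < K := by exact_mod_cast hK
  rw [← Finset.sum_filter_add_sum_filter_not (Finset.Icc 1 m) (fun j => j ≤ K)]
  have hA : ∑ j ∈ (Finset.Icc 1 m).filter (fun j => j ≤ K), wmaj ε j ≤ 1/2 * (1 + Real.log K) := by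
    have hh := harmonic_le_one_add_log K
    rw [harmonic_eq_sum_Icc] at hh
    push_cast at hh
    refine le_trans ?_ (mul_le_mul_of_nonneg_left hh (by norm_num))
    rw [Finset.mul_sum]
    have hsub : (Finset.Icc 1 m).filter (fun j => j ≤ K) ⊆ Finset.Icc 1 K := by
      intro j hj
      simp only [Finset.mem_filter, Finset.mem_Icc] at hj ⊢
      omega
    refine (Finset.sum_le_sum_of_subset_of_nonneg hsub (fun _ _ _ => wmaj_nonneg _ _)).trans ?_
    apply Finset.sum_le_sum
    intro j hj
    rw [Finset.mem_Icc] at hj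
    unfold wmaj
    rw [if_neg (by omega)]
    refine (min_le_left _ _).trans (le_of_eq ?_)
    have : (j:ℝ) ≠ 0 := by have : j ≠ 0 := by omega
                           exact_mod_cast this
    field_simp
  have hB : ∑ j ∈ (Finset.Icc 1 m).filter (fun j => ¬ j ≤ K), wmaj ε j ≤ 1 / 8 := by
    have h1 : ∀ j ∈ (Finset.Icc 1 m).filter (fun j => ¬ j ≤ K), wmaj ε j ≤ (1 / (8 * ε^2 * K)) * ((j:ℝ)^2)⁻¹ := by
      intro j hj
      simp only [Finset.mem_filter, Finset.mem_Icc, not_le] at hj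
      have hjK : (K:ℝ) ≤ j := by exact_mod_cast hj.2.le
      have hj0 : (0:ℝ) < j := by linarith
      unfold wmaj
      rw [if_neg (by omega)]
      refine (min_le_right _ _).trans ?_
      rw [← one_div, div_mul_div_comm, one_mul]
      apply one_div_le_one_div_of_le (by positivity)
      calc 8 * ε^2 * K * (j:ℝ)^2 ≤ 8 * ε^2 * j * (j:ℝ)^2 := by gcongr
        _ = _ := by ring
    refine (Finset.sum_le_sum h1).trans ?_
    rw [← Finset.mul_sum]
    refine (mul_le_mul_of_nonneg_left (wsum_aux m K hK) (by positivity)).trans ?_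
    rw [div_mul_div_comm, one_mul]
    apply one_div_le_one_div_of_le (by norm_num)
    have : 1 ≤ ε * K := by rw [div_le_iff₀ hε] at hK1; linarith
    nlinarith
  have hl : Real.log K ≤ Real.log (2 / ε) := Real.log_le_log hKr hK2
  have hl0 : 0 ≤ Real.log (2 / ε) := Real.log_nonneg (by rw [le_div_iff₀ hε]; linarith)
  linarith

lemma wsum2 (m : ℕ) (ε : ℝ) (hε : 0 < ε) (hε1 : ε ≤ 1) :
    ∑ j ∈ Finset.Icc 1 m, (j:ℝ) * wmaj ε j ≤ 2 / ε := by
  set K := ⌈1 / ε⌉₊ with hKd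
  have hK : 0 < K := Nat.ceil_pos.2 (by positivity)
  have hK1 : 1 / ε ≤ K := Nat.le_ceil _
  have hK2 : (K:ℝ) ≤ 2 / ε := by
    have := Nat.ceil_lt_add_one (a := 1 / ε) (by positivity)
    have h1 : 1 ≤ 1 / ε := by rw [le_div_iff₀ hε]; linarith
    have : (2:ℝ) / ε = 1 / ε + 1 / ε := by ring
    linarith
  have hKr : (0:ℝ) < K := by exact_mod_cast hK
  rw [← Finset.sum_filter_add_sum_filter_not (Finset.Icc 1 m) (fun j => j ≤ K)]
  have hA : ∑ j ∈ (Finset.Icc 1 m).filter (fun j => j ≤ K), (j:ℝ) * wmaj ε j ≤ K * (1/2) := by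
    have hsub : (Finset.Icc 1 m).filter (fun j => j ≤ K) ⊆ Finset.Icc 1 K := by
      intro j hj
      simp only [Finset.mem_filter, Finset.mem_Icc] at hj ⊢
      omega
    refine (Finset.sum_le_sum_of_subset_of_nonneg hsub
      (fun j _ _ => mul_nonneg (by positivity) (wmaj_nonneg _ _))).trans ?_
    calc _ ≤ ∑ j ∈ Finset.Icc 1 K, (1/2:ℝ) := by
          apply Finset.sum_le_sum
          intro j hj
          rw [Finset.mem_Icc] at hj
          have hj0 : (0:ℝ) < j := by exact_mod_cast hj.1
          unfold wmaj
          rw [if_neg (by omega)]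
          refine (mul_le_mul_of_nonneg_left (min_le_left _ _) hj0.le).trans (le_of_eq ?_)
          field_simp
      _ = _ := by simp
  have hB : ∑ j ∈ (Finset.Icc 1 m).filter (fun j => ¬ j ≤ K), (j:ℝ) * wmaj ε j ≤ 1 / (8 * ε) := by
    have h1 : ∀ j ∈ (Finset.Icc 1 m).filter (fun j => ¬ j ≤ K), (j:ℝ) * wmaj ε j ≤ (1 / (8 * ε^2)) * ((j:ℝ)^2)⁻¹ := by
      intro j hj
      simp only [Finset.mem_filter, Finset.mem_Icc, not_le] at hj
      have hj0 : (0:ℝ) < j := by exact_mod_cast hj.1.1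
      unfold wmaj
      rw [if_neg (by omega)]
      refine (mul_le_mul_of_nonneg_left (min_le_right _ _) hj0.le).trans (le_of_eq ?_)
      field_simp
    refine (Finset.sum_le_sum h1).trans ?_
    rw [← Finset.mul_sum]
    refine (mul_le_mul_of_nonneg_left (wsum_aux m K hK) (by positivity)).trans ?_
    rw [div_mul_div_comm, one_mul]
    apply one_div_le_one_div_of_le (by positivity)
    have : 1 ≤ ε * K := by rw [div_le_iff₀ hε] at hK1; linarith
    nlinarith
  have e : 1 / (8 * ε) = 1/8 * (1 / ε) := by field_simp
  have e2 : 2 / ε = 2 * (1 / ε) := by ring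
  have : 0 < 1 / ε := by positivity
  rw [e] at hB
  rw [e2] at hK2 ⊢
  linarith

lemma Wsum1 (m : ℕ) [NeZero m] (ε : ℝ) (hε : 0 < ε) (hε1 : ε ≤ 1) :
    ∑ h : ZMod m, wmaj ε (habs h) ≤ 6 + 2 * Real.log (2 / ε) := by
  refine (sum_habs m (wmaj ε) (wmaj_nonneg ε)).trans ?_
  have := wsum1 m ε hε hε1
  have h0 : wmaj ε 0 = 4 := by simp [wmaj]
  rw [h0]; linarith

lemma Wsum2 (m : ℕ) [NeZero m] (ε : ℝ) (hε : 0 < ε) (hε1 : ε ≤ 1) :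
    ∑ h : ZMod m, (habs h : ℝ) * wmaj ε (habs h) ≤ 4 / ε := by
  refine (sum_habs m (fun j => (j:ℝ) * wmaj ε j) (fun j => mul_nonneg (by positivity) (wmaj_nonneg ε j))).trans ?_
  have := wsum2 m ε hε hε1
  have e : 4 / ε = 2 * (2 / ε) := by ring
  simp only [Nat.cast_zero, zero_mul]
  rw [e]; linarith

/-- the product sum -/
lemma Wprod (d : ℕ) (m : ℕ) [NeZero m] (ε : ℝ) (hε : 0 < ε) (hε1 : ε ≤ 1) :
    ∑ h : Fin d → ZMod m, (∏ i, wmaj ε (habs (h i))) * (∑ i, (habs (h i) : ℝ))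
      ≤ d * ((4 / ε) * (6 + 2 * Real.log (2 / ε)) ^ (d - 1)) := by
  simp only [Finset.mul_sum]
  rw [Finset.sum_comm]
  have key : ∀ i : Fin d, ∑ h : Fin d → ZMod m, (∏ i, wmaj ε (habs (h i))) * (habs (h i) : ℝ)
      ≤ (4 / ε) * (6 + 2 * Real.log (2 / ε)) ^ (d - 1) := by
    intro i
    have e : ∀ h : Fin d → ZMod m, (∏ j, wmaj ε (habs (h j))) * (habs (h i) : ℝ) =
        ∏ j, ((if j = i then (habs (h j) : ℝ) else 1) * wmaj ε (habs (h j))) := by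
      intro h
      rw [Finset.prod_mul_distrib, Finset.prod_ite_eq' Finset.univ i]
      simp [mul_comm]
    simp only [e]
    have hp := Finset.prod_univ_sum (fun _ : Fin d => (Finset.univ : Finset (ZMod m)))
      (fun j x => ((if j = i then (habs x : ℝ) else 1) * wmaj ε (habs x)))
    rw [Fintype.piFinset_univ] at hp
    rw [← hp, ← Finset.mul_prod_erase Finset.univ _ (Finset.mem_univ i)]
    have h1 := Wsum1 m ε hε hε1
    have h2 := Wsum2 m ε hε hε1
    apply mul_le_mul
    · simpa using h2
    · calc _ ≤ ∏ j ∈ Finset.univ.erase i, (6 + 2 * Real.log (2 / ε)) := by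
            apply Finset.prod_le_prod
            · intro j hj
              apply Finset.sum_nonneg
              intro x _
              apply mul_nonneg _ (wmaj_nonneg _ _)
              split_ifs <;> positivity
            · intro j hj
              have : j ≠ i := (Finset.mem_erase.1 hj).1
              simpa [this] using h1
        _ = _ := by
            rw [Finset.prod_const, Finset.card_erase_of_mem (Finset.mem_univ i), Finset.card_univ, Fintype.card_fin]
    · apply Finset.prod_nonneg
      intro j hj
      apply Finset.sum_nonneg
      intro x _
      apply mul_nonneg _ (wmaj_nonneg _ _)
      split_ifs <;> positivity
    · positivity
  refine (Finset.sum_le_sum (fun i _ => key i)).trans ?_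
  simp

lemma addChar_sum {ι : Type*} [DecidableEq ι] {m : ℕ} (ψ : AddChar (ZMod m) ℂ) (s : Finset ι) (f : ι → ZMod m) :
    ψ (∑ i ∈ s, f i) = ∏ i ∈ s, ψ (f i) := by
  induction s using Finset.induction_on with
  | empty => simp
  | insert a s ha ih => rw [Finset.sum_insert ha, Finset.prod_insert ha, AddChar.map_add_eq_mul, ih]

lemma prod_perturb {ι : Type*} [DecidableEq ι] (s : Finset ι) (v : ι → ℝ) (e : ℝ) (he : 0 ≤ e) (he3 : e ≤ 3)
    (hv : ∀ i ∈ s, 0 ≤ v i ∧ v i ≤ 1) :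
    ∏ i ∈ s, (v i + e) ≤ ∏ i ∈ s, v i + e * 8 ^ s.card := by
  induction s using Finset.induction_on with
  | empty => simp [he]
  | insert a s ha ih =>
    rw [Finset.prod_insert ha, Finset.prod_insert ha, Finset.card_insert_of_notMem ha]
    have h1 := ih (fun i hi => hv i (Finset.mem_insert_of_mem hi))
    obtain ⟨h2, h3⟩ := hv a (Finset.mem_insert_self _ _)
    have hP0 : 0 ≤ ∏ i ∈ s, v i := Finset.prod_nonneg (fun i hi => (hv i (Finset.mem_insert_of_mem hi)).1)
    have hP1 : ∏ i ∈ s, v i ≤ 1 := Finset.prod_le_one (fun i hi => (hv i (Finset.mem_insert_of_mem hi)).1)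
      (fun i hi => (hv i (Finset.mem_insert_of_mem hi)).2)
    have h8 : (1:ℝ) ≤ 8 ^ s.card := one_le_pow₀ (by norm_num)
    calc (v a + e) * ∏ i ∈ s, (v i + e) ≤ (v a + e) * (∏ i ∈ s, v i + e * 8 ^ s.card) := by gcongr
      _ = v a * ∏ i ∈ s, v i + e * (v a * 8 ^ s.card + ∏ i ∈ s, v i + e * 8 ^ s.card) := by ring
      _ ≤ v a * ∏ i ∈ s, v i + e * (1 * 8 ^ s.card + 8 ^ s.card + 3 * 8 ^ s.card) := by
          gcongr; linarith
      _ ≤ _ := by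
          rw [pow_succ]
          nlinarith [mul_nonneg he (by positivity : (0:ℝ) ≤ 8 ^ s.card)]

lemma upper (d m : ℕ) [NeZero m] (t : Fin d → ZMod m) (L : ℕ) (hL : 0 < L) (hLm : L ≤ m)
    (R : ℝ) (hR : 0 ≤ R)
    (hram : ∀ h : Fin d → ZMod m, h ≠ 0 →
      1 / ((orderOf (ZMod.stdAddChar (∑ i, h i * t i))).totient : ℝ) ≤ R * ∑ i, (habs (h i) : ℝ))
    (a b : Fin d → ℝ) (hab : ∀ i, a i ≤ b i ∧ b i - a i ≤ 1) :
    ((((Finset.range m).filter (fun k => Nat.Coprime k m)).filter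
      (fun k : ℕ => ∀ i, a i ≤ (((k : ZMod m) * t i).val : ℝ) / m ∧ (((k : ZMod m) * t i).val : ℝ) / m < b i)).card : ℝ)
      / m.totient ≤ ∏ i, (b i - a i) + (3 * ((L:ℝ) / m) * 8 ^ d +
        R * (d * ((4 / ((L:ℝ) / m)) * (6 + 2 * Real.log (2 / ((L:ℝ) / m))) ^ (d - 1)))) := by
  have hm0 : 0 < m := NeZero.pos m
  have hm : (0:ℝ) < m := by exact_mod_cast hm0
  have hLr : (0:ℝ) < L := by exact_mod_cast hL
  set ε := (L:ℝ) / m with hεd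
  have hε : 0 < ε := by positivity
  have hε1 : ε ≤ 1 := by rw [hεd, div_le_one hm]; exact_mod_cast hLm
  have hφ : (0:ℝ) < m.totient := by exact_mod_cast Nat.totient_pos.2 hm0
  choose c g γ hg0 hg1 hgF hc0 hγ0 hγ1 hc using fun i => coord m L hL (a i) (b i) (hab i).1
  set S := (Finset.range m).filter (fun k => Nat.Coprime k m) with hS
  have hScard : (S.card : ℝ) = m.totient := by
    congr 1
    rw [hS, Nat.totient_eq_card_coprime]
    congr 1
    ext k
    simp [Nat.coprime_comm]
  -- count bounded by the smooth sum
  have hcount : ((S.filter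
      (fun k : ℕ => ∀ i, a i ≤ (((k : ZMod m) * t i).val : ℝ) / m ∧ (((k : ZMod m) * t i).val : ℝ) / m < b i)).card : ℝ)
      ≤ ∑ k ∈ S, ∏ i, g i ((k : ZMod m) * t i) := by
    rw [Finset.card_eq_sum_ones, Nat.cast_sum, Finset.sum_filter]
    apply Finset.sum_le_sum
    intro k _
    split_ifs with h
    · push_cast
      calc (1:ℝ) = ∏ i : Fin d, (1:ℝ) := by simp
        _ ≤ _ := Finset.prod_le_prod (fun _ _ => by norm_num) (fun i _ => hg1 i _ (h i).1 (h i).2)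
    · exact Finset.prod_nonneg (fun i _ => hg0 i _)
  have hfour : ((∑ k ∈ S, ∏ i, g i ((k : ZMod m) * t i) : ℝ) : ℂ) =
      ∑ h : Fin d → ZMod m, (∏ i, c i (h i)) * ∑ k ∈ S, (ZMod.stdAddChar (∑ i, h i * t i)) ^ k := by
    push_cast
    simp only [hgF]
    have : ∀ k ∈ S, ∏ i, ∑ h, c i h * ZMod.stdAddChar (h * ((k : ZMod m) * t i)) =
        ∑ h : Fin d → ZMod m, (∏ i, c i (h i)) * (ZMod.stdAddChar (∑ i, h i * t i)) ^ k := by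
      intro k _
      rw [Finset.prod_univ_sum, Fintype.piFinset_univ]
      apply Finset.sum_congr rfl
      intro h _
      rw [Finset.prod_mul_distrib]
      congr 1
      rw [← AddChar.map_nsmul_eq_pow, ← addChar_sum]
      congr 1
      rw [nsmul_eq_mul, Finset.mul_sum]
      apply Finset.sum_congr rfl
      intro i _
      ring
    rw [Finset.sum_congr rfl this, Finset.sum_comm]
    apply Finset.sum_congr rfl
    intro h _
    rw [Finset.mul_sum]
  have hcw : ∀ i h, ‖c i h‖ ≤ wmaj ε (habs h) := by
    intro i h
    by_cases hh : h = 0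
    · subst hh
      have h0 : habs (0 : ZMod m) = 0 := by simp [habs]
      rw [h0, hc0, Complex.norm_real, Real.norm_eq_abs, abs_of_nonneg (hγ0 i)]
      have : wmaj ε 0 = 4 := by simp [wmaj]
      rw [this]
      refine (hγ1 i).trans ?_
      have := (hab i).2
      have e : 3 * (L:ℝ) / m = 3 * ε := by rw [hεd]; ring
      rw [e]; linarith
    · have hp := habs_pos h hh
      have hpr : (0:ℝ) < habs h := by exact_mod_cast hp
      unfold wmaj
      rw [if_neg (by omega)]
      refine le_min (hc i h hh).1 ((hc i h hh).2.trans (le_of_eq ?_))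
      rw [hεd]; field_simp
  have hnorm : ‖((∑ k ∈ S, ∏ i, g i ((k : ZMod m) * t i) : ℝ) : ℂ)‖ ≤
      m.totient * ∏ i, γ i + m.totient * (R * (d * ((4 / ε) * (6 + 2 * Real.log (2 / ε)) ^ (d - 1)))) := by
    rw [hfour, ← Finset.add_sum_erase _ _ (Finset.mem_univ (0 : Fin d → ZMod m))]
    refine (norm_add_le _ _).trans (add_le_add (le_of_eq ?_) ?_)
    · simp only [Pi.zero_apply, zero_mul, Finset.sum_const_zero, AddChar.map_zero_eq_one, one_pow,
        Finset.sum_const, nsmul_eq_mul, mul_one, hc0]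
      rw [norm_mul, norm_prod, Complex.norm_natCast, hScard, mul_comm]
      congr 1
      apply Finset.prod_congr rfl
      intro i _
      rw [Complex.norm_real, Real.norm_eq_abs, abs_of_nonneg (hγ0 i)]
    · refine (norm_sum_le _ _).trans ?_
      have hterm : ∀ h ∈ (Finset.univ : Finset (Fin d → ZMod m)).erase 0,
          ‖(∏ i, c i (h i)) * ∑ k ∈ S, (ZMod.stdAddChar (∑ i, h i * t i)) ^ k‖ ≤
          m.totient * R * ((∏ i, wmaj ε (habs (h i))) * (∑ i, (habs (h i) : ℝ))) := by
        intro h hh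
        have hne : h ≠ 0 := (Finset.mem_erase.1 hh).1
        rw [norm_mul, norm_prod]
        have h1 : ∏ i, ‖c i (h i)‖ ≤ ∏ i, wmaj ε (habs (h i)) :=
          Finset.prod_le_prod (fun _ _ => norm_nonneg _) (fun i _ => hcw i _)
        have h2 := RS_bound m hm0 (ZMod.stdAddChar (∑ i, h i * t i)) (by
          rw [← AddChar.map_nsmul_eq_pow]; simp)
        have h3 := hram h hne
        calc _ ≤ (∏ i, wmaj ε (habs (h i))) * (m.totient * (R * ∑ i, (habs (h i) : ℝ))) := by
              apply mul_le_mul h1 _ (norm_nonneg _) (Finset.prod_nonneg (fun i _ => wmaj_nonneg _ _))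
              refine h2.trans ?_
              gcongr
          _ = _ := by ring
      refine (Finset.sum_le_sum hterm).trans ?_
      rw [← Finset.mul_sum, mul_assoc]
      apply mul_le_mul_of_nonneg_left _ hφ.le
      apply mul_le_mul_of_nonneg_left _ hR
      refine le_trans ?_ (Wprod d m ε hε hε1)
      apply Finset.sum_le_sum_of_subset_of_nonneg (Finset.erase_subset _ _)
      intro h _ _
      apply mul_nonneg (Finset.prod_nonneg (fun i _ => wmaj_nonneg _ _))
      positivity
  have hfin : ∑ k ∈ S, ∏ i, g i ((k : ZMod m) * t i) ≤
      m.totient * ∏ i, γ i + m.totient * (R * (d * ((4 / ε) * (6 + 2 * Real.log (2 / ε)) ^ (d - 1)))) := by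
    refine le_trans ?_ hnorm
    rw [Complex.norm_real, Real.norm_eq_abs]
    exact le_abs_self _
  have hγp : ∏ i, γ i ≤ ∏ i, (b i - a i) + 3 * ε * 8 ^ d := by
    have h1 : ∏ i, γ i ≤ ∏ i, ((b i - a i) + 3 * ε) := by
      apply Finset.prod_le_prod (fun i _ => hγ0 i)
      intro i _
      refine (hγ1 i).trans (le_of_eq ?_)
      rw [hεd]; ring
    have h2 := prod_perturb (Finset.univ : Finset (Fin d)) (fun i => b i - a i) (3 * ε) (by positivity)
      (by linarith) (fun i _ => ⟨by linarith [(hab i).1], (hab i).2⟩)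
    rw [Finset.card_univ, Fintype.card_fin] at h2
    exact h1.trans h2
  rw [div_le_iff₀ hφ]
  refine (hcount.trans hfin).trans ?_
  rw [← mul_add, mul_comm]
  apply mul_le_mul_of_nonneg_right _ hφ.le
  linarith

lemma disc_of_upper {d : ℕ} {ι : Type*} (S : Finset ι) (hS : S.Nonempty) (x : ι → Fin d → ℝ)
    (hx : ∀ k ∈ S, ∀ i, 0 ≤ x k i ∧ x k i < 1) (E : ℝ) (hE : 0 ≤ E)
    (hup : ∀ a b : Fin d → ℝ, (∀ i, 0 ≤ a i ∧ a i ≤ b i ∧ b i ≤ 1) →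
      ((S.filter (fun j => ∀ i, a i ≤ x j i ∧ x j i < b i)).card : ℝ) / S.card ≤ ∏ i, (b i - a i) + E) :
    discrepancyOn S x ≤ 3 ^ d * E := by
  have hn : (0:ℝ) < S.card := by exact_mod_cast hS.card_pos
  unfold discrepancyOn
  apply Real.sSup_le _ (by positivity)
  rintro r ⟨a, b, hab, rfl⟩
  let A : Fin 3 → Fin d → ℝ := ![a, fun _ => 0, b]
  let B : Fin 3 → Fin d → ℝ := ![b, a, fun _ => 1]
  let cnt : (Fin d → Fin 3) → ℝ := fun σ =>
    ((S.filter (fun j => ∀ i, A (σ i) i ≤ x j i ∧ x j i < B (σ i) i)).card : ℝ) / S.card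
  let vol : (Fin d → Fin 3) → ℝ := fun σ => ∏ i, (B (σ i) i - A (σ i) i)
  have hAB : ∀ q i, 0 ≤ A q i ∧ A q i ≤ B q i ∧ B q i ≤ 1 := by
    intro q i
    obtain ⟨h1, h2, h3⟩ := hab i
    fin_cases q
    · exact ⟨h1, h2.le, h3⟩
    · exact ⟨le_refl _, h1, by show a i ≤ 1; linarith⟩
    · exact ⟨by show 0 ≤ b i; linarith, h3, le_refl _⟩
  have hup' : ∀ σ, cnt σ ≤ vol σ + E := fun σ =>
    hup (fun i => A (σ i) i) (fun i => B (σ i) i) (fun i => hAB _ i)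
  have hvol : ∑ σ, vol σ = 1 := by
    have hp := Finset.prod_univ_sum (fun _ : Fin d => (Finset.univ : Finset (Fin 3)))
      (fun i q => B q i - A q i)
    rw [Fintype.piFinset_univ] at hp
    show ∑ σ : Fin d → Fin 3, ∏ i, (B (σ i) i - A (σ i) i) = 1
    rw [← hp]
    apply Finset.prod_eq_one
    intro i _
    rw [Fin.sum_univ_three]
    show (b i - a i) + (a i - 0) + (1 - b i) = 1
    ring
  have hcnt : ∑ σ, cnt σ = 1 := by
    show ∑ σ : Fin d → Fin 3, ((S.filter (fun j => ∀ i, A (σ i) i ≤ x j i ∧ x j i < B (σ i) i)).card : ℝ) / S.card = 1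
    rw [← Finset.sum_div, div_eq_one_iff_eq hn.ne']
    have e : ∀ σ : Fin d → Fin 3, ((S.filter (fun j => ∀ i, A (σ i) i ≤ x j i ∧ x j i < B (σ i) i)).card : ℝ)
        = ∑ j ∈ S, ∏ i, (if A (σ i) i ≤ x j i ∧ x j i < B (σ i) i then (1:ℝ) else 0) := by
      intro σ
      rw [Finset.card_eq_sum_ones, Nat.cast_sum, Finset.sum_filter]
      apply Finset.sum_congr rfl
      intro j _
      rw [Finset.prod_ite_zero]
      simp
    simp only [e]
    rw [Finset.sum_comm]
    rw [Finset.sum_congr rfl (g := fun _ => (1:ℝ))]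
    · simp
    intro j hj
    have hp := Finset.prod_univ_sum (fun _ : Fin d => (Finset.univ : Finset (Fin 3)))
      (fun i q => (if A q i ≤ x j i ∧ x j i < B q i then (1:ℝ) else 0))
    rw [Fintype.piFinset_univ] at hp
    rw [← hp]
    apply Finset.prod_eq_one
    intro i _
    rw [Fin.sum_univ_three]
    show (if a i ≤ x j i ∧ x j i < b i then (1:ℝ) else 0) + (if 0 ≤ x j i ∧ x j i < a i then (1:ℝ) else 0)
      + (if b i ≤ x j i ∧ x j i < 1 then (1:ℝ) else 0) = 1
    obtain ⟨h1, h2, h3⟩ := hab i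
    obtain ⟨h4, h5⟩ := hx j hj i
    rcases lt_or_ge (x j i) (a i) with h | h
    · rw [if_neg (by rintro ⟨p, q⟩; linarith), if_pos ⟨h4, h⟩, if_neg (by rintro ⟨p, q⟩; linarith)]; norm_num
    · rcases lt_or_ge (x j i) (b i) with h' | h'
      · rw [if_pos ⟨h, h'⟩, if_neg (by rintro ⟨p, q⟩; linarith), if_neg (by rintro ⟨p, q⟩; linarith)]; norm_num
      · rw [if_neg (by rintro ⟨p, q⟩; linarith), if_neg (by rintro ⟨p, q⟩; linarith), if_pos ⟨h', h5⟩]; norm_num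
  have h3 : (1:ℝ) ≤ 3 ^ d := one_le_pow₀ (by norm_num)
  have h0 : cnt 0 = ((S.filter (fun j => ∀ i, a i ≤ x j i ∧ x j i < b i)).card : ℝ) / S.card := rfl
  have h0' : vol 0 = ∏ i, (b i - a i) := rfl
  rw [← h0, ← h0', abs_le]
  constructor
  · have s1 := Finset.add_sum_erase Finset.univ cnt (Finset.mem_univ 0)
    have s2 := Finset.add_sum_erase Finset.univ vol (Finset.mem_univ 0)
    rw [hcnt] at s1
    rw [hvol] at s2
    have s3 : ∑ σ ∈ Finset.univ.erase 0, cnt σ ≤ ∑ σ ∈ Finset.univ.erase 0, vol σ + 3 ^ d * E := by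
      calc _ ≤ ∑ σ ∈ Finset.univ.erase (0 : Fin d → Fin 3), (vol σ + E) := Finset.sum_le_sum (fun σ _ => hup' σ)
        _ = ∑ σ ∈ Finset.univ.erase (0 : Fin d → Fin 3), vol σ + ∑ σ ∈ Finset.univ.erase (0 : Fin d → Fin 3), E :=
            Finset.sum_add_distrib
        _ ≤ ∑ σ ∈ Finset.univ.erase (0 : Fin d → Fin 3), vol σ + ∑ σ : Fin d → Fin 3, E := by
            gcongr
            exact Finset.erase_subset _ _
        _ = _ := by simp
    linarith
  · have := hup' 0
    nlinarith

lemma argVec_char (m : ℕ) [NeZero m] (z : ZMod m) :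
    Int.fract ((ZMod.stdAddChar z : ℂ).arg / (2 * Real.pi)) = (z.val : ℝ) / m := by
  have hm : (0:ℝ) < m := by exact_mod_cast NeZero.pos m
  have e : ZMod.stdAddChar z = Complex.exp (((2 * Real.pi * z.val / m : ℝ) : ℂ) * Complex.I) := by
    rw [ZMod.stdAddChar_apply, ZMod.toCircle_apply]
    congr 1
    push_cast
    ring
  rw [e, Complex.arg_exp_mul_I, toIocMod, zsmul_eq_mul]
  have e2 : (2 * Real.pi * z.val / m - (toIocDiv Real.two_pi_pos (-Real.pi) (2 * Real.pi * z.val / m) : ℝ) * (2 * Real.pi)) / (2 * Real.pi)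
     = (z.val : ℝ) / m - (toIocDiv Real.two_pi_pos (-Real.pi) (2 * Real.pi * z.val / m) : ℝ) := by
    have := Real.pi_pos
    field_simp
  rw [e2, Int.fract_sub_intCast, Int.fract_eq_self]
  refine ⟨by positivity, ?_⟩
  rw [div_lt_one hm]
  exact_mod_cast ZMod.val_lt z

lemma exists_log (m : ℕ) [NeZero m] (w : ℂ) (hw : w ^ m = 1) : ∃ t : ZMod m, ZMod.stdAddChar t = w := by
  obtain ⟨j, _, rfl⟩ := (Complex.isPrimitiveRoot_exp m (NeZero.ne m)).eq_pow_of_pow_eq_one hw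
  refine ⟨((j : ℤ) : ZMod m), ?_⟩
  rw [ZMod.stdAddChar_coe, ← Complex.exp_nat_mul]
  congr 1
  push_cast
  ring

lemma strict_le {d : ℕ} (ω : Fin d → ℂ) (a : Fin d → ℤ) (ha : a ≠ 0) (h : ∏ i, ω i ^ a i = 1) :
    strictDeg ω ≤ Finset.univ.sup (fun i => (a i).natAbs) :=
  Nat.sInf_le ⟨a, ha, h, rfl⟩

lemma strict_basic {d : ℕ} (hd : 1 ≤ d) (ω : Fin d → ℂ) (m : ℕ) (hm : 0 < m) (hω : ∀ i, ω i ^ m = 1) :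
    0 < strictDeg ω ∧ strictDeg ω ≤ m := by
  have hne : (fun i : Fin d => (m : ℤ)) ≠ 0 := by
    intro h
    have := congrFun h ⟨0, hd⟩
    simp at this
    omega
  have hp : ∏ i, ω i ^ ((fun i : Fin d => (m : ℤ)) i) = 1 := by
    apply Finset.prod_eq_one
    intro i _
    simp [hω i]
  constructor
  · have hmem : strictDeg ω ∈ {n | ∃ a : Fin d → ℤ, a ≠ 0 ∧ (∏ i, ω i ^ a i) = 1 ∧
      Finset.univ.sup (fun i => (a i).natAbs) = n} := Nat.sInf_mem ⟨_, _, hne, hp, rfl⟩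
    obtain ⟨a, ha, _, h⟩ := hmem
    rw [← h]
    obtain ⟨i, hi⟩ := Function.ne_iff.1 ha
    have := Finset.le_sup (f := fun i => (a i).natAbs) (Finset.mem_univ i)
    simp only [Pi.zero_apply] at hi this
    omega
  · refine (strict_le ω _ hne hp).trans ?_
    apply Finset.sup_le
    intro i _
    simp

lemma strict_order {d : ℕ} (m : ℕ) [NeZero m] (t : Fin d → ZMod m) (h : Fin d → ZMod m) (hh : h ≠ 0) :
    strictDeg (fun i => (ZMod.stdAddChar (t i) : ℂ)) ≤
      orderOf (ZMod.stdAddChar (∑ i, h i * t i) : ℂ) * ∑ i, habs (h i) := by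
  set n := orderOf (ZMod.stdAddChar (∑ i, h i * t i) : ℂ) with hn
  have hpow : (ZMod.stdAddChar (∑ i, h i * t i) : ℂ) ^ m = 1 := by
    rw [← AddChar.map_nsmul_eq_pow]; simp
  have hn0 : 0 < n := Nat.pos_of_dvd_of_pos (orderOf_dvd_of_pow_eq_one hpow) (NeZero.pos m)
  refine (strict_le _ (fun i => (n : ℤ) * (h i).valMinAbs) ?_ ?_).trans ?_
  · intro h0
    apply hh
    funext i
    have := congrFun h0 i
    simp only [Pi.zero_apply, mul_eq_zero] at this
    rcases this with h1 | h1
    · omega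
    · exact (ZMod.valMinAbs_eq_zero _).1 h1
  · have e : ∀ i, (ZMod.stdAddChar (t i) : ℂ) ^ ((n : ℤ) * (h i).valMinAbs) = (ZMod.stdAddChar (h i * t i) : ℂ) ^ n := by
      intro i
      rw [mul_comm, zpow_mul, zpow_natCast, ← AddChar.map_zsmul_eq_zpow, zsmul_eq_mul, ZMod.coe_valMinAbs]
    simp only [e]
    rw [Finset.prod_pow, ← addChar_sum, hn, pow_orderOf_eq_one]
  · apply Finset.sup_le
    intro i _
    simp only [Int.natAbs_mul, Int.natAbs_natCast]
    apply Nat.mul_le_mul_left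
    exact Finset.single_le_sum (f := fun i => habs (h i)) (fun _ _ => Nat.zero_le _) (Finset.mem_univ i)

lemma final_est (d : ℕ) (K : ℝ) (hK : 0 < K) (δ m : ℕ) (hδ : 0 < δ) (hδm : δ ≤ m) (L : ℕ)
    (η : ℝ) (hηd : η = (1 + Real.log (Real.log (3 * δ))) / Real.sqrt δ) (hη1 : η ≤ 1)
    (hLd : L = ⌈η * m⌉₊) :
    0 < L ∧ L ≤ m ∧ 
    (3 * ((L:ℝ) / m) * 8 ^ d +
        (K * (1 + Real.log (Real.log (3 * δ)))^2 / δ) * (d * ((4 / ((L:ℝ) / m)) * (6 + 2 * Real.log (2 / ((L:ℝ) / m))) ^ (d - 1))))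
    ≤ η * ((6 * 8 ^ d * 2 ^ (d-1) + 4 * d * K * 14 ^ (d-1)) * (Real.log (2 * δ)) ^ (d-1)) := by
  have hδ1 : (1:ℝ) ≤ δ := by exact_mod_cast hδ
  have hm0 : 0 < m := by omega
  have hm : (0:ℝ) < m := by exact_mod_cast hm0
  have hδm' : (δ:ℝ) ≤ m := by exact_mod_cast hδm
  have hll : 0 ≤ Real.log (Real.log (3 * δ)) := Real.log_nonneg (NT_log3 δ hδ1)
  set LL := 1 + Real.log (Real.log (3 * δ)) with hLL
  have hLL1 : 1 ≤ LL := by linarith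
  have hsq : 0 < Real.sqrt δ := Real.sqrt_pos.2 (by linarith)
  have hsq1 : 1 ≤ Real.sqrt δ := Real.one_le_sqrt.2 hδ1
  have hsqs : Real.sqrt δ * Real.sqrt δ = δ := Real.mul_self_sqrt (by linarith)
  have hη : 0 < η := by rw [hηd]; positivity
  have hηs : 1 / Real.sqrt δ ≤ η := by rw [hηd]; gcongr
  have hL : 0 < L := by rw [hLd]; exact Nat.ceil_pos.2 (by positivity)
  have hLm : L ≤ m := by
    rw [hLd, Nat.ceil_le]; nlinarith
  refine ⟨hL, hLm, ?_⟩
  have hLr : (0:ℝ) < L := by exact_mod_cast hL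
  set ε := (L:ℝ) / m with hεd
  have hε : 0 < ε := by positivity
  have hεη : η ≤ ε := by
    rw [hεd, le_div_iff₀ hm, hLd]; exact Nat.le_ceil _
  have hε2 : ε ≤ 2 * η := by
    rw [hεd, div_le_iff₀ hm]
    have h1 := Nat.ceil_lt_add_one (a := η * m) (by positivity)
    rw [← hLd] at h1
    have h2 : 1 ≤ η * m := by
      calc (1:ℝ) ≤ 1 / Real.sqrt δ * δ := by
            rw [one_div, ← div_eq_inv_mul, le_div_iff₀ hsq]; nlinarith
        _ ≤ η * m := by gcongr
    linarith
  set Q := Real.log (2 * δ) with hQ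
  have hQ2 : 1 / 2 ≤ Q := by
    have h1 : Real.log 2 ≤ Q := Real.log_le_log (by norm_num) (by linarith)
    have := Real.log_two_gt_d9
    linarith
  have hlog : Real.log (2 / ε) ≤ Q := by
    apply Real.log_le_log (by positivity)
    rw [div_le_iff₀ hε]
    have h1 : 1 / Real.sqrt δ ≤ ε := hηs.trans hεη
    have : (2:ℝ) * δ * (1 / Real.sqrt δ) ≤ 2 * δ * ε := by gcongr
    have e : (2:ℝ) * δ * (1 / Real.sqrt δ) = 2 * Real.sqrt δ := by
      rw [mul_one_div, div_eq_iff hsq.ne', mul_assoc, hsqs]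
    linarith
  have hε1 : ε ≤ 1 := by rw [hεd, div_le_one hm]; exact_mod_cast hLm
  have hlog0 : 0 ≤ Real.log (2 / ε) := Real.log_nonneg (by rw [le_div_iff₀ hε]; linarith)
  have hP : (6 + 2 * Real.log (2 / ε)) ^ (d - 1) ≤ 14 ^ (d-1) * Q ^ (d-1) := by
    rw [← mul_pow]
    apply pow_le_pow_left₀ (by linarith)
    linarith
  have h1Q : (1:ℝ) ≤ 2 ^ (d-1) * Q ^ (d-1) := by
    rw [← mul_pow]
    apply one_le_pow₀; linarith
  have hA : 3 * ε * 8 ^ d ≤ η * (6 * 8 ^ d * (2 ^ (d-1) * Q ^ (d-1))) := by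
    calc 3 * ε * 8 ^ d ≤ 3 * (2 * η) * 8 ^ d := by gcongr
      _ = η * (6 * 8 ^ d * 1) := by ring
      _ ≤ _ := by gcongr
  have hB : (K * LL^2 / δ) * (d * ((4 / ε) * (6 + 2 * Real.log (2 / ε)) ^ (d - 1)))
     ≤ η * (4 * d * K * (14 ^ (d-1) * Q ^ (d-1))) := by
    calc _ ≤ (K * LL^2 / δ) * (d * ((4 / η) * (14 ^ (d-1) * Q ^ (d-1)))) := by gcongr
      _ = (LL^2 / δ / η) * (4 * d * K * (14 ^ (d-1) * Q ^ (d-1))) := by ring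
      _ = _ := by
          congr 1
          rw [div_eq_iff hη.ne', hηd, div_mul_div_comm, hsqs]
          ring
  calc _ ≤ _ := add_le_add hA hB
    _ = _ := by ring

theorem discrepancy_of_galois_orbit (d : ℕ) (hd : 1 ≤ d) :
    ∃ C : ℝ, 0 < C ∧
      ∀ (ω : Fin d → ℂ) (m : ℕ), 0 < m → (∀ i, ω i ^ m = 1) →
        (∀ m' : ℕ, 0 < m' → (∀ i, ω i ^ m' = 1) → m ≤ m') →
        discrepancyOn ((Finset.range m).filter (fun k => Nat.Coprime k m))
            (fun k => argVec (fun i => ω i ^ k)) ≤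
          C * (Real.log (2 * (strictDeg ω : ℝ))) ^ (d - 1) *
            Real.log (Real.log (3 * (strictDeg ω : ℝ))) / Real.sqrt (strictDeg ω : ℝ) := by
  obtain ⟨K, hK, hNT⟩ := NT_totient2
  have hlog3 : 1 < Real.log 3 := by
    rw [Real.lt_log_iff_exp_lt (by norm_num)]
    have := Real.exp_one_lt_d9
    linarith
  set κ := Real.log (Real.log 3) with hκd
  have hκ : 0 < κ := Real.log_pos hlog3
  set C0 : ℝ := 6 * 8 ^ d * 2 ^ (d-1) + 4 * d * K * 14 ^ (d-1) with hC0
  have hC0p : 0 < C0 := by positivity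
  refine ⟨3 ^ d * C0 * (1 / κ + 1), by positivity, ?_⟩
  intro ω m hm hω _
  have hne : NeZero m := ⟨hm.ne'⟩
  choose t ht using fun i => exists_log m (ω i) (hω i)
  obtain ⟨hδ, hδm⟩ := strict_basic hd ω m hm hω
  have hωt : (fun i => (ZMod.stdAddChar (t i) : ℂ)) = ω := funext ht
  have hord := fun h hh => strict_order m t h hh
  rw [hωt] at hord
  set δ := strictDeg ω with hδd
  have hδ1 : (1:ℝ) ≤ δ := by exact_mod_cast hδ
  set S := (Finset.range m).filter (fun k => Nat.Coprime k m) with hS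
  have hScard : S.card = m.totient := by
    rw [hS, Nat.totient_eq_card_coprime]
    congr 1
    ext k
    simp [Nat.coprime_comm]
  have hSne : S.Nonempty := by
    rw [← Finset.card_pos, hScard]; exact Nat.totient_pos.2 hm
  have hx : ∀ (k : ℕ) (i : Fin d), argVec (fun i => ω i ^ k) i = (((k : ZMod m) * t i).val : ℝ) / m := by
    intro k i
    show Int.fract ((ω i ^ k).arg / (2 * Real.pi)) = _
    rw [← argVec_char, ← ht i, ← AddChar.map_nsmul_eq_pow, nsmul_eq_mul]
  have hll : κ ≤ Real.log (Real.log (3 * δ)) :=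
    Real.log_le_log (by linarith) (Real.log_le_log (by norm_num) (by linarith))
  set ll := Real.log (Real.log (3 * (δ:ℝ))) with hlld
  have hsq : 0 < Real.sqrt δ := Real.sqrt_pos.2 (by linarith)
  set η := (1 + ll) / Real.sqrt δ with hη
  have hη0 : 0 < η := by
    have : 0 < 1 + ll := by linarith
    positivity
  set Q := Real.log (2 * (δ:ℝ)) with hQ
  have hQ2 : 1 / 2 ≤ Q := by
    have h1 : Real.log 2 ≤ Q := Real.log_le_log (by norm_num) (by linarith)
    have := Real.log_two_gt_d9
    linarith
  have hdisc : discrepancyOn S (fun k => argVec (fun i => ω i ^ k)) ≤ 3 ^ d * (η * (C0 * Q ^ (d-1))) := by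
    apply disc_of_upper S hSne
    · intro k _ i
      rw [hx]
      have hmr : (0:ℝ) < m := by exact_mod_cast hm
      refine ⟨by positivity, ?_⟩
      rw [div_lt_one hmr]
      exact_mod_cast ZMod.val_lt _
    · positivity
    · intro a b hab
      rcases le_or_gt η 1 with hη1 | hη1
      · obtain ⟨hL, hLm, hest⟩ := final_est d K hK δ m hδ hδm _ η hη hη1 rfl
        refine le_trans ?_ (add_le_add_right hest _)
        have := upper d m t _ hL hLm (K * (1 + ll)^2 / δ) (by positivity) (by
          intro h hh
          have ho := hord h hh
          have hs : (1:ℝ) ≤ ∑ i, (habs (h i) : ℝ) := by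
            obtain ⟨i, hi⟩ := Function.ne_iff.1 hh
            have h1 := habs_pos (h i) hi
            have h2 := Finset.single_le_sum (f := fun i => habs (h i)) (fun _ _ => Nat.zero_le _) (Finset.mem_univ i)
            have h3 : 1 ≤ ∑ i, habs (h i) := h1.trans h2
            exact_mod_cast h3
          have hn0 : 0 < orderOf (ZMod.stdAddChar (∑ i, h i * t i) : ℂ) := by
            rcases Nat.eq_zero_or_pos (orderOf (ZMod.stdAddChar (∑ i, h i * t i) : ℂ)) with h0 | h0
            · rw [h0] at ho; omega
            · exact h0
          refine (hNT _ δ _ hn0 hδ hs (by exact_mod_cast ho)).trans (le_of_eq ?_)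
          ring) a b (fun i => ⟨(hab i).2.1, by linarith [(hab i).1, (hab i).2.2]⟩)
        rw [hScard]
        simp only [hx]
        exact this
      · have h1 : ((S.filter (fun j => ∀ i, a i ≤ argVec (fun i => ω i ^ j) i ∧ argVec (fun i => ω i ^ j) i < b i)).card : ℝ) / S.card ≤ 1 := by
          apply div_le_one_of_le₀ _ (Nat.cast_nonneg _)
          exact Nat.cast_le.2 (Finset.card_filter_le _ _)
        have h2 : 0 ≤ ∏ i, (b i - a i) := Finset.prod_nonneg (fun i _ => by linarith [(hab i).2.1])
        have h3 : 1 ≤ C0 * Q ^ (d-1) := by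
          have h1Q : (1:ℝ) ≤ 2 ^ (d-1) * Q ^ (d-1) := by
            rw [← mul_pow]
            apply one_le_pow₀; linarith
          have h8 : (1:ℝ) ≤ 8 ^ d := one_le_pow₀ (by norm_num)
          have h4 : 0 ≤ 4 * d * K * 14 ^ (d-1) * Q ^ (d-1) := by positivity
          have e : C0 * Q ^ (d-1) = 6 * 8 ^ d * (2 ^ (d-1) * Q ^ (d-1)) + 4 * d * K * 14 ^ (d-1) * Q ^ (d-1) := by
            rw [hC0]; ring
          rw [e]
          nlinarith
        refine h1.trans ?_
        nlinarith
  refine hdisc.trans ?_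
  have hfin : 1 + ll ≤ (1 / κ + 1) * ll := by
    have : 1 ≤ 1 / κ * ll := by rw [one_div, ← div_eq_inv_mul, le_div_iff₀ hκ]; linarith
    linarith
  rw [hη]
  calc _ = (3 ^ d * C0 * Q ^ (d-1)) * (1 + ll) / Real.sqrt δ := by ring
    _ ≤ (3 ^ d * C0 * Q ^ (d-1)) * ((1 / κ + 1) * ll) / Real.sqrt δ := by gcongr
    _ = _ := by ring
end
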